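/- arXiv:0902.2467 — 3 statements merged into one kernel-verified Lean document; each statement's English description precedes it below -/
import Mathlib

section
/- Let A and B be k-algebras of finite transcendence degree over k such that B is an integral domain, and let p be a prime ideal of A. Then for every prime ideal P of A⊗_kB that is minimal over the ideal p⊗_kB, one has ht(P) = ht(p⊗_kB) = ht(p[t.d.(B)]), where p[t.d.(B)] denotes the extension of p to the polynomial ring A[X_1,...,X_{t.d.(B)}]. -/
open TensorProduct

noncomputable section

/-- Transcendence degree of the `R`-algebra `A` as a cardinal: the supremum of the
cardinalities of algebraically independent subsets of `A` over `R`. -/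
def trdegC (R A : Type*) [CommRing R] [CommRing A] [Algebra R A] : Cardinal :=
  ⨆ s : { s : Set A // AlgebraicIndependent R ((↑) : s → A) }, Cardinal.mk s.1

/-- Transcendence degree of the `R`-algebra `A`, as an extended natural number. -/
def eTrdeg (R A : Type*) [CommRing R] [CommRing A] [Algebra R A] : ℕ∞ :=
  Cardinal.toENat (trdegC R A)

/-- Height of an ideal: the infimum of the heights of the prime ideals containing it,
the height of a prime being taken in the prime spectrum ordered by inclusion. -/
def idealHt {R : Type*} [CommRing R] (I : Ideal R) : ℕ∞ :=
  ⨅ P : { P : PrimeSpectrum R // I ≤ P.asIdeal }, Order.height P.1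

/-- The extension `p[n]` of an ideal `p` of `A` to the polynomial ring
`A[X_1, ..., X_n]`. -/
def polyExt {A : Type*} [CommRing A] (n : ℕ) (p : Ideal A) : Ideal (MvPolynomial (Fin n) A) :=
  p.map (MvPolynomial.C : A →+* MvPolynomial (Fin n) A)

/-- An AF-domain over `k`: a `k`-algebra which is an integral domain such that
`ht p + t.d.(A/p) = t.d.(A)` for every prime ideal `p` of `A`. -/
def IsAFDomain (k A : Type*) [Field k] [CommRing A] [IsDomain A] [Algebra k A] : Prop :=
  ∀ p : Ideal A, p.IsPrime → idealHt p + eTrdeg k (A ⧸ p) = eTrdeg k A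

section HeightComparison

variable {R S : Type*} [CommRing R] [CommRing S]

theorem strictMono_comap_of_isIntegralElem_unit_mul {f : R →+* S}
    (h : ∀ z : S, ∃ u : S, IsUnit u ∧ f.IsIntegralElem (u * z)) :
    StrictMono (PrimeSpectrum.comap f) := by
  intro P Q hPQ
  algebraize_only [f]
  obtain ⟨z, hzQ, hzP⟩ := SetLike.exists_of_lt (show P.asIdeal < Q.asIdeal from hPQ)
  obtain ⟨u, hu, hz⟩ := h z
  exact Ideal.comap_lt_comap_of_integral_mem_sdiff (le_of_lt hPQ)
    ⟨Q.asIdeal.mul_mem_left u hzQ, fun hP ↦ hzP ((Ideal.unit_mul_mem_iff_mem _ hu).mp hP)⟩ hz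

theorem GeneralizingMap.exists_le_comap_eq {f : R →+* S}
    (hf : GeneralizingMap (PrimeSpectrum.comap f)) {P : PrimeSpectrum S} {q : PrimeSpectrum R}
    (hq : q ≤ PrimeSpectrum.comap f P) : ∃ Q ≤ P, PrimeSpectrum.comap f Q = q := by
  obtain ⟨Q, hQ, rfl⟩ := hf ((PrimeSpectrum.le_iff_specializes _ _).mp hq)
  exact ⟨Q, (PrimeSpectrum.le_iff_specializes _ _).mpr hQ, rfl⟩

theorem height_comap_eq_of_generalizingMap {f : R →+* S}
    (hf : GeneralizingMap (PrimeSpectrum.comap f)) (hf' : StrictMono (PrimeSpectrum.comap f))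
    (P : PrimeSpectrum S) : Order.height (PrimeSpectrum.comap f P) = Order.height P := by
  refine (Order.height_eq_of_strictMono _ hf' (fun Q q hq ↦ ?_) P).symm
  obtain ⟨Q', hQ', rfl⟩ := hf.exists_le_comap_eq hq.le
  exact ⟨Q', hQ'.lt_of_ne fun h ↦ hq.ne (h ▸ rfl), rfl⟩

theorem idealHt_asIdeal (P : PrimeSpectrum R) : idealHt P.asIdeal = Order.height P :=
  le_antisymm (iInf_le_of_le ⟨P, le_rfl⟩ le_rfl)
    (le_iInf fun Q ↦ Order.height_mono (show P ≤ Q.1 from Q.2))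

theorem idealHt_eq_of_forall_minimalPrimes {I P : Ideal R} (hP : P ∈ I.minimalPrimes) {n : ℕ∞}
    (h : ∀ Q ∈ I.minimalPrimes, idealHt Q = n) : idealHt I = n := by
  refine le_antisymm ?_ (le_iInf fun Q ↦ ?_)
  · have := hP.1.1
    rw [← h P hP]
    exact le_iInf fun Q ↦ iInf_le_of_le ⟨Q.1, hP.1.2.trans Q.2⟩ le_rfl
  · obtain ⟨Q', hQ', hle⟩ := Ideal.exists_minimalPrimes_le Q.2
    have := hQ'.1.1
    rw [← h Q' hQ', idealHt_asIdeal ⟨Q', this⟩]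
    exact Order.height_mono (show (⟨Q', this⟩ : PrimeSpectrum R) ≤ Q.1 from hle)

theorem idealHt_comap_ringEquiv (e : R ≃+* S) (q : Ideal S) [hq : q.IsPrime] :
    idealHt (q.comap e.toRingHom) = idealHt q := by
  have := height_comap_eq_of_generalizingMap (f := e.toRingHom)
    (RingHom.Flat.of_bijective e.bijective).generalizingMap_comap
    (strictMono_comap_of_isIntegralElem_unit_mul fun z ↦ ⟨1, isUnit_one, by
      simpa using e.toRingHom.isIntegralElem_map (x := e.symm z)⟩) ⟨q, hq⟩
  rwa [← idealHt_asIdeal, ← idealHt_asIdeal] at this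

end HeightComparison

section TensorProduct

variable {k : Type*} (A D K : Type*) [Field k] [CommRing A] [CommRing D] [Field K]
  [Algebra k A] [Algebra k D] [Algebra k K] [Algebra D K] [IsScalarTower k D K]

theorem Module.Flat.of_isDomain_of_field [IsDomain D] [FaithfulSMul D K] : Module.Flat D K := by
  let : Algebra (FractionRing D) K := FractionRing.liftAlgebra D K
  have : IsScalarTower D (FractionRing D) K := FractionRing.isScalarTower_liftAlgebra D K
  have : Module.Flat D (FractionRing D) := IsLocalization.flat _ (nonZeroDivisors D)
  exact Module.Flat.trans D (FractionRing D) K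

variable (k) in
/-- The map `A ⊗[k] D → A ⊗[k] K` induced by the structure map of the `D`-algebra `K`. -/
abbrev tensorBaseMap : A ⊗[k] D →ₐ[A] A ⊗[k] K :=
  Algebra.TensorProduct.map (AlgHom.id A A) (IsScalarTower.toAlgHom k D K)

theorem generalizingMap_comap_tensorBaseMap [IsDomain D] [FaithfulSMul D K] :
    GeneralizingMap (PrimeSpectrum.comap (tensorBaseMap k A D K).toRingHom) := by
  have := Module.Flat.of_isDomain_of_field D K
  exact (RingHom.Flat.tensorProductMap (RingHom.Flat.id A)
    (RingHom.flat_algebraMap_iff.mpr this)).generalizingMap_comap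

theorem exists_isIntegralElem_tensorBaseMap [IsDomain D] [Algebra.IsAlgebraic D K] (z : A ⊗[k] K) :
    ∃ d : D, d ≠ 0 ∧ (tensorBaseMap k A D K).toRingHom.IsIntegralElem
      (1 ⊗ₜ algebraMap D K d * z) := by
  set f := (tensorBaseMap k A D K).toRingHom
  have hf (a : A) (d : D) : f (a ⊗ₜ d) = a ⊗ₜ algebraMap D K d := by simp [f]
  induction z with
  | zero => exact ⟨1, one_ne_zero, by simpa using f.isIntegralElem_zero⟩
  | tmul a c =>
    obtain ⟨d, hd, hc⟩ := (Algebra.IsAlgebraic.isAlgebraic (R := D) c).exists_integral_multiple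
    refine ⟨d, hd, ?_⟩
    have hc' : f.IsIntegralElem (1 ⊗ₜ (d • c)) := by
      obtain ⟨q, hq, hqc⟩ := hc
      let i : K →+* A ⊗[k] K := (Algebra.TensorProduct.includeRight : K →ₐ[k] A ⊗[k] K)
      let j : D →+* A ⊗[k] D := (Algebra.TensorProduct.includeRight : D →ₐ[k] A ⊗[k] D)
      refine ⟨q.map j, hq.map j, ?_⟩
      have hij : f.comp j = i.comp (algebraMap D K) := by
        ext x
        exact hf 1 x
      rw [Polynomial.eval₂_map, hij]
      exact (Polynomial.hom_eval₂ q (algebraMap D K) i (d • c)).symm.trans (by rw [hqc, map_zero])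
    have := (f.isIntegralElem_map (x := a ⊗ₜ 1)).mul f hc'
    rw [hf] at this
    simpa [Algebra.smul_def] using this
  | add y z hy hz =>
    obtain ⟨d, hd, hy⟩ := hy
    obtain ⟨e, he, hz⟩ := hz
    refine ⟨d * e, mul_ne_zero hd he, ?_⟩
    have h1 := (f.isIntegralElem_map (x := 1 ⊗ₜ e)).mul f hy
    have h2 := (f.isIntegralElem_map (x := 1 ⊗ₜ d)).mul f hz
    have hsum : 1 ⊗ₜ algebraMap D K (d * e) * (y + z) =
        f (1 ⊗ₜ e) * (1 ⊗ₜ algebraMap D K d * y) + f (1 ⊗ₜ d) * (1 ⊗ₜ algebraMap D K e * z) := by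
      rw [hf, hf, ← mul_assoc, ← mul_assoc, mul_add]
      simp [mul_comm]
    rw [hsum]
    exact h1.add f h2

theorem strictMono_comap_tensorBaseMap [IsDomain D] [FaithfulSMul D K]
    [Algebra.IsAlgebraic D K] :
    StrictMono (PrimeSpectrum.comap (tensorBaseMap k A D K).toRingHom) := by
  refine strictMono_comap_of_isIntegralElem_unit_mul fun z ↦ ?_
  obtain ⟨d, hd, hz⟩ := exists_isIntegralElem_tensorBaseMap A D K z
  have hu : IsUnit (algebraMap D K d) := by simpa using hd
  exact ⟨_, hu.map (Algebra.TensorProduct.includeRight : K →ₐ[k] A ⊗[k] K), hz⟩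

variable (k) {A} in
/-- The extension `p ⊗ D` of an ideal `p` of `A` to `A ⊗[k] D`. -/
abbrev tensorExt (p : Ideal A) : Ideal (A ⊗[k] D) :=
  p.map (Algebra.TensorProduct.includeLeft : A →ₐ[k] A ⊗[k] D).toRingHom

variable {A}

theorem tensorExt_eq_ker (p : Ideal A) (C : Type*) [CommRing C] [Algebra k C] :
    tensorExt k C p =
      RingHom.ker (Algebra.TensorProduct.map (Ideal.Quotient.mkₐ k p) (AlgHom.id k C)) := by
  rw [Algebra.TensorProduct.rTensor_ker _ (Ideal.Quotient.mkₐ_surjective k p),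
    show RingHom.ker (Ideal.Quotient.mkₐ k p) = p from Ideal.Quotient.mkₐ_ker k p]
  rfl

theorem comap_tensorExt [FaithfulSMul D K] (p : Ideal A) :
    (tensorExt k K p).comap (tensorBaseMap k A D K).toRingHom = tensorExt k D p := by
  have hinj : Function.Injective (tensorBaseMap k (A ⧸ p) D K) :=
    Module.Flat.lTensor_preserves_injective_linearMap (M := A ⧸ p)
      (IsScalarTower.toAlgHom k D K).toLinearMap (FaithfulSMul.algebraMap_injective D K)
  have hcomm (x : A ⊗[k] D) :
      Algebra.TensorProduct.map (Ideal.Quotient.mkₐ k p) (AlgHom.id k K)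
        (tensorBaseMap k A D K x) =
      tensorBaseMap k (A ⧸ p) D K
        (Algebra.TensorProduct.map (Ideal.Quotient.mkₐ k p) (AlgHom.id k D) x) := by
    induction x with
    | zero => simp
    | tmul a d => simp
    | add x y hx hy => simp only [map_add, hx, hy]
  ext x
  rw [Ideal.mem_comap, tensorExt_eq_ker, tensorExt_eq_ker, RingHom.mem_ker, RingHom.mem_ker]
  exact (congrArg (· = 0) (hcomm x)).to_iff.trans (map_eq_zero_iff _ hinj)

theorem map_tensorExt (p : Ideal A) :
    (tensorExt k D p).map (tensorBaseMap k A D K).toRingHom = tensorExt k K p := by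
  rw [tensorExt, Ideal.map_map]
  congr 1
  ext a
  simp

theorem comap_mem_minimalPrimes_tensorExt [IsDomain D] [FaithfulSMul D K] {p : Ideal A}
    {P : PrimeSpectrum (A ⊗[k] K)} (hP : P.asIdeal ∈ (tensorExt k K p).minimalPrimes) :
    (PrimeSpectrum.comap (tensorBaseMap k A D K).toRingHom P).asIdeal ∈
      (tensorExt k D p).minimalPrimes := by
  refine ⟨⟨inferInstance, (comap_tensorExt D K p).ge.trans (Ideal.comap_mono hP.1.2)⟩, ?_⟩
  rintro q ⟨hq, hpq⟩ hle
  obtain ⟨Q, hQ, h⟩ := (generalizingMap_comap_tensorBaseMap A D K).exists_le_comap_eq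
    (q := ⟨q, hq⟩) hle
  have hQ' : tensorExt k K p ≤ Q.asIdeal := by
    rw [← map_tensorExt D, Ideal.map_le_iff_le_comap]
    exact hpq.trans_eq (congrArg PrimeSpectrum.asIdeal h).symm
  exact (Ideal.comap_mono (hP.2 ⟨Q.2, hQ'⟩ hQ)).trans_eq (congrArg PrimeSpectrum.asIdeal h)

theorem exists_minimalPrimes_tensorExt_idealHt_eq [IsDomain D] [FaithfulSMul D K]
    [Algebra.IsAlgebraic D K]
    {p : Ideal A} {P : Ideal (A ⊗[k] D)} (hP : P ∈ (tensorExt k D p).minimalPrimes) :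
    ∃ Q ∈ (tensorExt k K p).minimalPrimes, idealHt P = idealHt Q := by
  rw [← comap_tensorExt D K p] at hP
  obtain ⟨Q, hQ, rfl⟩ := Ideal.exists_minimalPrimes_comap_eq _ _ hP
  refine ⟨Q, hQ, ?_⟩
  have hQ' := hQ.1.1
  have := height_comap_eq_of_generalizingMap (generalizingMap_comap_tensorBaseMap (k := k) A D K)
    (strictMono_comap_tensorBaseMap A D K) ⟨Q, hQ'⟩
  rwa [← idealHt_asIdeal, ← idealHt_asIdeal] at this

theorem idealHt_eq_of_mem_minimalPrimes_tensorExt [IsDomain D] [FaithfulSMul D K]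
    [Algebra.IsAlgebraic D K]
    {p : Ideal A} (hp : (tensorExt k D p).IsPrime) {Q : Ideal (A ⊗[k] K)}
    (hQ : Q ∈ (tensorExt k K p).minimalPrimes) :
    idealHt Q = idealHt (tensorExt k D p) := by
  have hQ' := hQ.1.1
  have h := comap_mem_minimalPrimes_tensorExt D K (P := ⟨Q, hQ'⟩) hQ
  rw [Ideal.minimalPrimes_eq_subsingleton_self, Set.mem_singleton_iff] at h
  have := height_comap_eq_of_generalizingMap (generalizingMap_comap_tensorBaseMap (k := k) A D K)
    (strictMono_comap_tensorBaseMap A D K) ⟨Q, hQ'⟩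
  rw [← h, idealHt_asIdeal, this, ← idealHt_asIdeal]

end TensorProduct

section Polynomial

variable {A : Type*} [CommRing A]

theorem polyExt_isPrime (n : ℕ) (p : Ideal A) [p.IsPrime] : (polyExt n p).IsPrime := by
  have := MvPolynomial.ker_map (σ := Fin n) (Ideal.Quotient.mk p)
  rw [Ideal.mk_ker] at this
  rw [polyExt, ← this]
  exact RingHom.ker_isPrime _

theorem comap_algebraTensorAlgEquiv_polyExt (k : Type*) [Field k] [Algebra k A] (n : ℕ)
    (p : Ideal A) :
    (polyExt n p).comap
      (MvPolynomial.algebraTensorAlgEquiv (σ := Fin n) k A).toRingEquiv.toRingHom =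
      tensorExt k (MvPolynomial (Fin n) k) p := by
  set e := (MvPolynomial.algebraTensorAlgEquiv (σ := Fin n) k A).toRingEquiv
  have h : (tensorExt k (MvPolynomial (Fin n) k) p).map e.toRingHom = polyExt n p := by
    rw [tensorExt, Ideal.map_map, polyExt]
    congr 1
    ext a : 1
    simp [e, MvPolynomial.smul_eq_C_mul]
  rw [← h]
  exact Ideal.comap_map_of_bijective e.toRingHom e.bijective

end Polynomial

theorem exists_isTranscendenceBasis_fin {k B : Type*} [Field k] [CommRing B] [IsDomain B]
    [Algebra k B] {n : ℕ} (h : eTrdeg k B = n) :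
    ∃ x : Fin n → B, IsTranscendenceBasis k x := by
  obtain ⟨ι, x, hx⟩ := exists_isTranscendenceBasis' k B
  have h1 : Cardinal.toENat (Algebra.trdeg k B) = n := h
  rw [← hx.cardinalMk_eq_trdeg, Cardinal.toENat_eq_natCast] at h1
  obtain ⟨e⟩ := Cardinal.mk_eq_nat_iff.mp h1
  exact ⟨x ∘ e.symm, hx.comp_equiv e.symm⟩

theorem idealHt_eq_idealHt_polyExt_of_mem_minimalPrimes {k A B : Type*} [Field k] [CommRing A]
    [CommRing B] [IsDomain B] [Algebra k A] [Algebra k B] {n : ℕ} {x : Fin n → B}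
    (hx : IsTranscendenceBasis k x) (p : Ideal A) [p.IsPrime] {P : Ideal (A ⊗[k] B)}
    (hP : P ∈ (tensorExt k B p).minimalPrimes) : idealHt P = idealHt (polyExt n p) := by
  let M := MvPolynomial (Fin n) k
  let : Algebra M B := (MvPolynomial.aeval x).toAlgebra
  have hMB (m : M) : algebraMap M B m = MvPolynomial.aeval x m := rfl
  have : IsScalarTower k M B := .of_algebraMap_eq fun c ↦ by simp [hMB, M]
  have : FaithfulSMul M B := (faithfulSMul_iff_algebraMap_injective M B).mpr hx.1
  have : Algebra.IsAlgebraic M B := by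
    have := hx.isAlgebraic
    refine Algebra.IsAlgebraic.of_ringHom_of_comp_eq hx.1.aevalEquiv (RingHom.id B)
      hx.1.aevalEquiv.surjective Function.injective_id (RingHom.ext fun m ↦ ?_)
    exact hx.1.algebraMap_aevalEquiv m
  let K := FractionRing B
  have : FaithfulSMul M K := FaithfulSMul.trans M B K
  have : Algebra.IsAlgebraic B K := IsLocalization.isAlgebraic K (nonZeroDivisors B)
  have : Algebra.IsAlgebraic M K := Algebra.IsAlgebraic.trans M B K
  have hprime := polyExt_isPrime n p
  have hM : (tensorExt k M p).IsPrime := by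
    rw [← comap_algebraTensorAlgEquiv_polyExt]
    exact Ideal.comap_isPrime _ _
  obtain ⟨Q, hQ, hPQ⟩ := exists_minimalPrimes_tensorExt_idealHt_eq B K hP
  rw [hPQ, idealHt_eq_of_mem_minimalPrimes_tensorExt M K hM hQ,
    ← comap_algebraTensorAlgEquiv_polyExt k, idealHt_comap_ringEquiv]

/-- If `B` is a domain and `p` is a prime ideal of `A`, then every prime `P`
of `A ⊗[k] B` minimal over `p ⊗ B` satisfies `ht P = ht (p ⊗ B) = ht (p[t.d.(B)])`. -/
theorem stmt_0 (k A B : Type) [Field k] [CommRing A] [CommRing B] [IsDomain B]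
    [Algebra k A] [Algebra k B] (ta tb : ℕ)
    (hta : eTrdeg k A = ta) (htb : eTrdeg k B = tb)
    (p : Ideal A) (hp : p.IsPrime)
    (P : Ideal (A ⊗[k] B))
    (hP : P ∈ (p.map (Algebra.TensorProduct.includeLeft :
        A →ₐ[k] A ⊗[k] B).toRingHom).minimalPrimes) :
    idealHt P = idealHt (p.map (Algebra.TensorProduct.includeLeft :
        A →ₐ[k] A ⊗[k] B).toRingHom) ∧
    idealHt (p.map (Algebra.TensorProduct.includeLeft : A →ₐ[k] A ⊗[k] B).toRingHom)
      = idealHt (polyExt tb p) := by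
  obtain ⟨x, hx⟩ := exists_isTranscendenceBasis_fin htb
  have h := idealHt_eq_of_forall_minimalPrimes hP fun Q hQ ↦
    idealHt_eq_idealHt_polyExt_of_mem_minimalPrimes hx p hQ
  exact ⟨(idealHt_eq_idealHt_polyExt_of_mem_minimalPrimes hx p hP).trans h.symm, h⟩
end
end

section
/- Let T be an integral domain which is a k-algebra of finite transcendence degree over k, M a maximal ideal of T, K := T/M, φ : T → K the canonical surjection, D a proper subring of K, and A := φ^{-1}(D). If T and D are AF-domains, then the polynomial ring A[X_1,...,X_{t.d.(K:D)}] is an AF-domain, where t.d.(K:D) denotes the transcendence degree of the field K over the quotient field of D. -/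
open TensorProduct

noncomputable section

open Order

universe u

theorem nat_le_height_induction {α : Type*} [Preorder α] {p : ℕ → α → Prop}
    (zero : ∀ a, p 0 a) (succ : ∀ m a b, a < b → p m a → p (m + 1) b) :
    ∀ (m : ℕ) (a : α), (m : ℕ∞) ≤ height a → p m a := by
  intro m
  induction m with
  | zero => exact fun a _ => zero a
  | succ m ih =>
    intro a ha
    obtain ⟨s, rfl, hm⟩ := exists_series_of_le_height a ha
    exact succ m (s ⟨m, by omega⟩) _ (s.strictMono (Fin.lt_def.2 (by simp [hm])))
      (ih _ (by simpa using index_le_height s ⟨m, by omega⟩))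

theorem add_le_of_forall_nat_le {a b c d : ℕ∞}
    (h : ∀ m : ℕ, (m : ℕ∞) ≤ a → m + b ≤ c + d) : a + b ≤ c + d := by
  by_cases ha : a = ⊤
  · have : c + d = ⊤ := ENat.eq_top_iff_forall_ge.2 fun m =>
      le_trans (by simp) (h m (by simp [ha]))
    simp [this]
  · lift a to ℕ using ha
    exact h a le_rfl

theorem height_add_height_le {α β : Type*} [Preorder α] [Preorder β] {f : α → β}
    (hf : StrictMono f) {b : β} (hb : ∀ a, b ≤ f a) (a : α) :
    height a + height b ≤ height (f a) := by
  have key := nat_le_height_induction (p := fun m a => m + height b ≤ height (f a))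
    (fun a => by simpa using height_mono (hb a)) fun m a a' haa' h => by
      refine le_trans ?_ (height_add_one_le (hf haa'))
      calc ((m + 1 : ℕ) : ℕ∞) + height b = m + height b + 1 := by push_cast; ring
        _ ≤ _ := by gcongr
  simpa using add_le_of_forall_nat_le (c := height (f a)) (d := 0) (by simpa using (key · a))

theorem trdeg_add_one_le_of_not_injective {k : Type*} {B C : Type u} [Field k] [CommRing B]
    [IsDomain B] [CommRing C] [IsDomain C] [Algebra k B] [Algebra k C] (f : B →ₐ[k] C)
    (hf : Function.Surjective f) (hker : ¬ Function.Injective f) :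
    Algebra.trdeg k C + 1 ≤ Algebra.trdeg k B := by
  obtain ⟨x, hx, hx0⟩ : ∃ x, f x = 0 ∧ x ≠ 0 := by
    simpa [injective_iff_map_eq_zero] using hker
  obtain ⟨ι, y, hy⟩ := exists_isTranscendenceBasis' k C
  obtain ⟨z, rfl⟩ : ∃ z : ι → B, f ∘ z = y :=
    ⟨fun i => (hf (y i)).choose, funext fun i => (hf (y i)).choose_spec⟩
  have hz : AlgebraicIndependent k z := hy.1.of_comp f
  have htr : Transcendental (Algebra.adjoin k (Set.range z)) x := by
    intro halg
    obtain ⟨⟨c, hc⟩, hc0, t, ht⟩ := halg.exists_nonzero_dvd (mem_nonZeroDivisors_of_ne_zero hx0)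
    rw [Algebra.adjoin_range_eq_range_aeval] at hc
    obtain ⟨g, rfl⟩ := hc
    have hfg : f (MvPolynomial.aeval z g) = 0 := by
      have ht' : MvPolynomial.aeval z g = x * t := ht
      rw [ht', map_mul, hx, zero_mul]
    have hg : g = 0 := by
      apply hy.1
      rw [map_zero, ← hfg, ← AlgHom.comp_apply, MvPolynomial.comp_aeval]
      rfl
    subst hg
    exact hc0 (by ext; simp)
  have := ((hz.option_iff_transcendental x).2 htr).cardinalMk_le_trdeg
  rwa [Cardinal.mk_option, hy.cardinalMk_eq_trdeg] at this

theorem height_add_trdeg_le (k : Type*) {B : Type*} [Field k] [CommRing B] [IsDomain B]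
    [Algebra k B] (P : PrimeSpectrum B) :
    height P + Cardinal.toENat (Algebra.trdeg k (B ⧸ P.asIdeal)) ≤
      Cardinal.toENat (Algebra.trdeg k B) := by
  have key := nat_le_height_induction (p := fun m (P : PrimeSpectrum B) =>
      m + Cardinal.toENat (Algebra.trdeg k (B ⧸ P.asIdeal)) ≤
        Cardinal.toENat (Algebra.trdeg k B))
    (fun P => by
      simpa using OrderHomClass.mono Cardinal.toENat (trdeg_le_of_surjective
        (Ideal.Quotient.mkₐ k P.asIdeal) (Ideal.Quotient.mkₐ_surjective k _)))
    fun m P Q hPQ h => by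
      refine le_trans ?_ h
      have hle : P.asIdeal ≤ Q.asIdeal := hPQ.le
      have := trdeg_add_one_le_of_not_injective (Ideal.Quotient.factorₐ k hle)
        (Ideal.Quotient.factor_surjective hle) fun hinj => hPQ.not_ge fun x hx => by
          rw [← Ideal.Quotient.eq_zero_iff_mem]
          apply hinj
          simpa [Ideal.Quotient.eq_zero_iff_mem] using hx
      have := OrderHomClass.mono Cardinal.toENat this
      rw [map_add, map_one] at this
      calc ((m + 1 : ℕ) : ℕ∞) + Cardinal.toENat (Algebra.trdeg k (B ⧸ Q.asIdeal))
          = m + (Cardinal.toENat (Algebra.trdeg k (B ⧸ Q.asIdeal)) + 1) := by push_cast; ring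
        _ ≤ _ := by gcongr
  simpa using add_le_of_forall_nat_le (c := Cardinal.toENat (Algebra.trdeg k B)) (d := 0)
    (by simpa using (key · P))

theorem eTrdeg_eq (R A : Type*) [CommRing R] [CommRing A] [Algebra R A] :
    eTrdeg R A = Cardinal.toENat (Algebra.trdeg R A) := rfl

theorem idealHt_eq_height {R : Type*} [CommRing R] (P : PrimeSpectrum R) :
    idealHt P.asIdeal = height P :=
  le_antisymm (iInf_le_of_le ⟨P, le_rfl⟩ le_rfl) (le_iInf fun Q => height_mono Q.2)

/-- The extension of a prime of `A` to the polynomial ring over `A`. -/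
def primeExt (σ : Type*) {A : Type*} [CommRing A] (p : PrimeSpectrum A) :
    PrimeSpectrum (MvPolynomial σ A) where
  asIdeal := p.asIdeal.map MvPolynomial.C
  isPrime := by
    rw [← Ideal.mk_ker (I := p.asIdeal), ← MvPolynomial.ker_map]
    exact RingHom.ker_isPrime _

theorem mem_primeExt {σ A : Type*} [CommRing A] {p : PrimeSpectrum A} {f : MvPolynomial σ A} :
    f ∈ (primeExt σ p).asIdeal ↔ ∀ m, f.coeff m ∈ p.asIdeal :=
  MvPolynomial.mem_map_C_iff

theorem primeExt_strictMono (σ A : Type*) [CommRing A] :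
    StrictMono (primeExt σ : PrimeSpectrum A → _) := by
  have h : ∀ p q : PrimeSpectrum A, primeExt σ p ≤ primeExt σ q ↔ p ≤ q := fun p q => by
    refine ⟨fun h a ha => ?_, fun h => Ideal.map_mono h⟩
    have h1 : MvPolynomial.C a ∈ (primeExt σ q).asIdeal := h (Ideal.mem_map_of_mem _ ha)
    simpa using mem_primeExt.1 h1 0
  intro p q hpq
  exact lt_of_le_not_ge ((h _ _).2 hpq.le) fun hh => hpq.not_ge ((h _ _).1 hh)

section PartialEvaluation

variable {σ A L : Type*} [CommRing A] [CommRing L] [Algebra A L]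

open scoped Classical in
/-- The substitution of `x i` for the variables `X i` with `i ∈ J`. -/
def partialAeval (x : σ → L) (J : Set σ) : MvPolynomial σ A →ₐ[A] MvPolynomial σ L :=
  MvPolynomial.aeval fun i => if i ∈ J then MvPolynomial.C (x i) else MvPolynomial.X i

theorem partialAeval_X_of_mem {x : σ → L} {J : Set σ} {i : σ} (hi : i ∈ J) :
    partialAeval (A := A) x J (MvPolynomial.X i) = MvPolynomial.C (x i) := by
  simp [partialAeval, hi]

theorem partialAeval_X_of_notMem {x : σ → L} {J : Set σ} {i : σ} (hi : i ∉ J) :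
    partialAeval (A := A) x J (MvPolynomial.X i) = MvPolynomial.X i := by
  simp [partialAeval, hi]

theorem partialAeval_eq_zero_of_subset {x : σ → L} {I J : Set σ} (hIJ : I ⊆ J)
    {f : MvPolynomial σ A} (hf : partialAeval x I f = 0) : partialAeval x J f = 0 := by
  have : partialAeval (A := A) x J =
      ((partialAeval (A := L) x J).restrictScalars A).comp (partialAeval x I) := by
    ext1 i
    by_cases hi : i ∈ I
    · simp [partialAeval_X_of_mem hi, partialAeval_X_of_mem (hIJ hi)]
    · simp [partialAeval_X_of_notMem hi]
      simp [partialAeval]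
  rw [this, AlgHom.comp_apply, hf, map_zero]

theorem partialAeval_univ (x : σ → L) (f : MvPolynomial σ A) :
    partialAeval x Set.univ f = MvPolynomial.C (MvPolynomial.aeval x f) := by
  have : partialAeval (A := A) x Set.univ =
      (IsScalarTower.toAlgHom A L (MvPolynomial σ L)).comp (MvPolynomial.aeval x) := by
    ext1 i
    simp [partialAeval, MvPolynomial.algebraMap_eq]
  rw [this]; rfl

theorem exists_partialAeval_eq_C {x : σ → L} {S : Set σ} {c : L}
    (hc : c ∈ Algebra.adjoin A (x '' S)) :
    ∃ f : MvPolynomial σ A, ∀ J, S ⊆ J → partialAeval x J f = MvPolynomial.C c := by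
  induction hc using Algebra.adjoin_induction with
  | mem c hc =>
    obtain ⟨i, hi, rfl⟩ := hc
    exact ⟨MvPolynomial.X i, fun J hJ => partialAeval_X_of_mem (hJ hi)⟩
  | algebraMap r =>
    exact ⟨algebraMap _ _ r, fun J _ => by
      rw [AlgHom.commutes, IsScalarTower.algebraMap_apply A L (MvPolynomial σ L)]; rfl⟩
  | add a b _ _ ha hb =>
    obtain ⟨f, hf⟩ := ha
    obtain ⟨g, hg⟩ := hb
    exact ⟨f + g, fun J hJ => by simp [hf J hJ, hg J hJ]⟩
  | mul a b _ _ ha hb =>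
    obtain ⟨f, hf⟩ := ha
    obtain ⟨g, hg⟩ := hb
    exact ⟨f * g, fun J hJ => by simp [hf J hJ, hg J hJ]⟩

theorem exists_partialAeval_ne_zero {x : σ → L} {S J : Set σ} (hSJ : S ⊆ J) {i : σ} (hi : i ∉ J)
    {h : Polynomial L} (h0 : h ≠ 0) (hcoeff : ∀ e, h.coeff e ∈ Algebra.adjoin A (x '' S))
    (heval : h.eval (x i) = 0) :
    ∃ f : MvPolynomial σ A, partialAeval x J f ≠ 0 ∧ partialAeval x (insert i J) f = 0 := by
  choose c hc using fun e => exists_partialAeval_eq_C (hcoeff e)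
  refine ⟨∑ e ∈ Finset.range (h.natDegree + 1), c e * MvPolynomial.X i ^ e, ?_, ?_⟩
  · have : Polynomial.aeval (MvPolynomial.X i : MvPolynomial σ L) h ≠ 0 := fun h1 =>
      h0 (transcendental_iff.1 (MvPolynomial.transcendental_X L i) h h1)
    simpa [hc _ _ hSJ, partialAeval_X_of_notMem hi, Polynomial.aeval_eq_sum_range,
      MvPolynomial.smul_eq_C_mul] using this
  · have hSJ' := hSJ.trans (Set.subset_insert i J)
    rw [Polynomial.eval_eq_sum_range] at heval
    simp only [map_sum, map_mul, map_pow, hc _ _ hSJ',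
      partialAeval_X_of_mem (Set.mem_insert i J)]
    simp only [← map_pow, ← map_mul, ← map_sum, heval, map_zero]

variable [IsDomain L]

/-- The kernel of `partialAeval x J`, as a point of the prime spectrum. -/
def partialAevalKer (A : Type*) [CommRing A] [Algebra A L] (x : σ → L) (J : Set σ) :
    PrimeSpectrum (MvPolynomial σ A) :=
  ⟨RingHom.ker (partialAeval (A := A) x J), RingHom.ker_isPrime _⟩

/-- If the `x i` with `i ∉ S` are algebraic over `A[x i | i ∈ S]`, the kernel of the evaluation
at `x` contains a chain of length `#σ - #S` above the extension of a prime of `A`. -/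
theorem height_primeExt_add_card_le [Fintype σ] (x : σ → L) (P : PrimeSpectrum (MvPolynomial σ A))
    (hP : ∀ f, f ∈ P.asIdeal ↔ MvPolynomial.aeval x f = 0) (p : PrimeSpectrum A)
    (hp : ∀ a ∈ p.asIdeal, algebraMap A L a = 0) (S : Finset σ)
    (hS : ∀ i ∉ S, ∃ h : Polynomial L, h ≠ 0 ∧
      (∀ e, h.coeff e ∈ Algebra.adjoin A (x '' (S : Set σ))) ∧ h.eval (x i) = 0) :
    height (primeExt σ p) + Fintype.card σ ≤ height P + S.card := by
  classical
  have hPuniv : P = partialAevalKer A x Set.univ := by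
    ext f
    rw [hP]
    change _ ↔ partialAeval x Set.univ f = 0
    rw [partialAeval_univ, MvPolynomial.C_eq_zero]
  have hpS : primeExt σ p ≤ partialAevalKer A x S := by
    refine Ideal.map_le_iff_le_comap.2 fun a ha => ?_
    rw [Ideal.mem_comap]
    change partialAeval x _ (MvPolynomial.C a) = 0
    rw [← MvPolynomial.algebraMap_eq, AlgHom.commutes,
      IsScalarTower.algebraMap_apply A L (MvPolynomial σ L), hp a ha, map_zero]
  have hlt : ∀ (J : Set σ) (i : σ), (S : Set σ) ⊆ J → i ∉ J →
      partialAevalKer A x J < partialAevalKer A x (insert i J) := fun J i hSJ hi => by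
    obtain ⟨h, h0, h1, h2⟩ := hS i fun h => hi (hSJ h)
    obtain ⟨f, hf, hf'⟩ := exists_partialAeval_ne_zero hSJ hi h0 h1 h2
    exact lt_of_le_not_ge
      (fun g hg => partialAeval_eq_zero_of_subset (Set.subset_insert i J) hg)
      fun hge => hf (hge hf')
  have key : ∀ T : Finset σ, Disjoint S T →
      height (primeExt σ p) + T.card ≤ height (partialAevalKer A x (S ∪ T : Finset σ)) := by
    intro T
    induction T using Finset.induction_on with
    | empty => intro _; simpa using height_mono hpS
    | insert i T hi ih =>
      intro hd
      rw [Finset.disjoint_insert_right] at hd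
      have := hlt (S ∪ T : Finset σ) i (by simp) (by simp [hi, hd.1])
      have := height_add_one_le this
      rw [Finset.card_insert_of_notMem hi, Finset.union_insert, Finset.coe_insert]
      refine le_trans ?_ this
      push_cast
      rw [← add_assoc]
      gcongr
      simpa using ih hd.2
  have h1 := key Sᶜ disjoint_compl_right
  rw [Finset.union_compl, Finset.coe_univ, ← hPuniv] at h1
  rw [← Finset.card_compl_add_card S, Nat.cast_add, ← add_assoc]
  gcongr

end PartialEvaluation

theorem height_primeExt_add_card_add_trdeg_le (k : Type*) {σ A B L : Type u} [Field k] [Fintype σ]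
    [CommRing A] [CommRing B] [CommRing L] [IsDomain L] [Algebra A B] [Algebra A L] [Algebra B L]
    [Algebra k B] [Algebra k L] [IsScalarTower k B L] [IsScalarTower A B L] [FaithfulSMul B L]
    (hAB : Function.Surjective (algebraMap A B)) (x : σ → L)
    (P : PrimeSpectrum (MvPolynomial σ A))
    (hP : ∀ f, f ∈ P.asIdeal ↔ MvPolynomial.aeval x f = 0) (p : PrimeSpectrum A)
    (hp : ∀ a ∈ p.asIdeal, algebraMap A L a = 0) :
    height (primeExt σ p) + Fintype.card σ + Cardinal.toENat (Algebra.trdeg k B) ≤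
      height P + Cardinal.toENat (Algebra.trdeg k L) := by
  classical
  have hBL := FaithfulSMul.algebraMap_injective B L
  have : IsDomain B := hBL.isDomain (algebraMap B L)
  obtain ⟨S, hS⟩ := Set.Finite.exists_maximal
    (Set.toFinite {S : Finset σ | AlgebraicIndepOn B x (S : Set σ)})
    ⟨∅, by simpa [AlgebraicIndepOn, algebraicIndependent_empty_type_iff] using hBL⟩
  have hadj : ∀ s : Set L, ∀ c ∈ Algebra.adjoin B s, c ∈ Algebra.adjoin A s := by
    intro s c hc
    induction hc using Algebra.adjoin_induction with
    | mem c hc => exact Algebra.subset_adjoin hc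
    | algebraMap r =>
      obtain ⟨a, rfl⟩ := hAB r
      rw [← IsScalarTower.algebraMap_apply]
      exact Subalgebra.algebraMap_mem _ a
    | add a b _ _ ha hb => exact add_mem ha hb
    | mul a b _ _ ha hb => exact mul_mem ha hb
  have h1 := height_primeExt_add_card_le x P hP p hp S fun i hi => by
    have halg : IsAlgebraic (Algebra.adjoin B (x '' (S : Set σ))) (x i) := by
      by_contra htr
      have hins : insert i S ≤ S := hS.2 (by
        simpa using (AlgebraicIndepOn.insert_iff (s := (S : Set σ)) (by simpa using hi)).2
          ⟨hS.1, htr⟩) (Finset.subset_insert i S)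
      exact hi (hins (Finset.mem_insert_self i S))
    obtain ⟨h, h0, hh⟩ := halg
    refine ⟨h.map (algebraMap _ L), ?_, fun e => ?_, ?_⟩
    · rwa [Ne, Polynomial.map_eq_zero_iff Subtype.val_injective]
    · rw [Polynomial.coeff_map]
      exact hadj _ _ (h.coeff e).2
    · rwa [Polynomial.eval_map_algebraMap]
  have h2 : (S.card : Cardinal) ≤ Algebra.trdeg B L := by
    have h : AlgebraicIndependent B (fun i : (S : Set σ) => x i) := hS.1
    simpa using h.cardinalMk_le_trdeg
  have h3 : (S.card : ℕ∞) ≤ Cardinal.toENat (Algebra.trdeg B L) := by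
    simpa using OrderHomClass.mono Cardinal.toENat h2
  rw [← trdeg_add_eq (R := k) (S := B) (A := L), map_add]
  calc _ ≤ height P + S.card + Cardinal.toENat (Algebra.trdeg k B) := by gcongr
    _ ≤ height P + Cardinal.toENat (Algebra.trdeg B L) + Cardinal.toENat (Algebra.trdeg k B) := by
      gcongr
    _ = _ := by ring

theorem height_primeExt_add_trdeg_le (k : Type*) {σ A : Type u} [Field k] [Fintype σ] [CommRing A]
    [Algebra k A] (P : PrimeSpectrum (MvPolynomial σ A)) (p : PrimeSpectrum A)
    (hp : p.asIdeal = P.asIdeal.comap MvPolynomial.C) :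
    height (primeExt σ p) + Fintype.card σ + Cardinal.toENat (Algebra.trdeg k (A ⧸ p.asIdeal)) ≤
      height P + Cardinal.toENat (Algebra.trdeg k (MvPolynomial σ A ⧸ P.asIdeal)) := by
  have : P.asIdeal.LiesOver p.asIdeal := ⟨hp⟩
  have : FaithfulSMul (A ⧸ p.asIdeal) (MvPolynomial σ A ⧸ P.asIdeal) := inferInstance
  have : IsScalarTower k (A ⧸ p.asIdeal) (MvPolynomial σ A ⧸ P.asIdeal) := inferInstance
  refine height_primeExt_add_card_add_trdeg_le k (A := A) Ideal.Quotient.mk_surjective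
    (fun i => Ideal.Quotient.mk _ (MvPolynomial.X i)) P (fun f => ?_) p fun a ha => ?_
  · have : (MvPolynomial.aeval fun i => Ideal.Quotient.mk P.asIdeal (MvPolynomial.X i)) =
        Ideal.Quotient.mkₐ A P.asIdeal := by
      ext i; simp
    rw [this, Ideal.Quotient.mkₐ_eq_mk, Ideal.Quotient.eq_zero_iff_mem]
  · rw [hp] at ha
    exact Ideal.Quotient.eq_zero_iff_mem.2 ha

theorem isAFDomain_mvPolynomial {k A σ : Type u} [Field k] [CommRing A] [IsDomain A] [Algebra k A]
    [Fintype σ] (h : ∀ p : PrimeSpectrum A, Cardinal.toENat (Algebra.trdeg k A) ≤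
      height (primeExt σ p) + Cardinal.toENat (Algebra.trdeg k (A ⧸ p.asIdeal))) :
    IsAFDomain k (MvPolynomial σ A) := by
  intro P hP
  rw [eTrdeg_eq, eTrdeg_eq, idealHt_eq_height ⟨P, hP⟩]
  refine le_antisymm (height_add_trdeg_le k ⟨P, hP⟩) ?_
  let p : PrimeSpectrum A := PrimeSpectrum.comap MvPolynomial.C ⟨P, hP⟩
  rw [← trdeg_add_eq (R := k) (S := A) (A := MvPolynomial σ A), map_add,
    MvPolynomial.trdeg_of_isDomain, Cardinal.lift_id, Cardinal.mk_fintype, map_natCast]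
  refine le_trans ?_ (height_primeExt_add_trdeg_le k ⟨P, hP⟩ p rfl)
  rw [add_right_comm]
  gcongr
  exact h p

section Conductor

variable {R S : Type*} [CommRing R] [CommRing S] {f : R →+* S} {m : S}

theorem comap_lt_comap_of_conductor (hm : ∀ x, m * x ∈ f.range) {P Q : PrimeSpectrum S}
    (hPQ : P < Q) (hmP : m ∉ P.asIdeal) : PrimeSpectrum.comap f P < PrimeSpectrum.comap f Q := by
  refine lt_of_le_not_ge (Ideal.comap_mono hPQ.le) fun hge => hPQ.not_ge fun x hx => ?_
  obtain ⟨r, hr⟩ := hm x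
  have h1 : r ∈ (PrimeSpectrum.comap f P).asIdeal := hge (by
    change f r ∈ Q.asIdeal
    rw [hr]
    exact Ideal.mul_mem_left _ _ hx)
  have h2 : m * x ∈ P.asIdeal := hr ▸ h1
  exact (P.isPrime.mem_or_mem h2).resolve_left hmP

theorem height_le_height_comap_of_conductor (hm : ∀ x, m * x ∈ f.range) (P : PrimeSpectrum S)
    (hmP : m ∉ P.asIdeal) : height P ≤ height (PrimeSpectrum.comap f P) := by
  have key := nat_le_height_induction (p := fun j (P : PrimeSpectrum S) =>
      m ∉ P.asIdeal → (j : ℕ∞) ≤ height (PrimeSpectrum.comap f P)) (fun _ _ => by simp)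
    fun j P Q hPQ h hmQ => by
      have hmP : m ∉ P.asIdeal := fun hmP => hmQ (hPQ.le hmP)
      refine le_trans ?_ (height_add_one_le (comap_lt_comap_of_conductor hm hPQ hmP))
      push_cast
      gcongr
      exact h hmP
  exact ENat.forall_natCast_le_iff_le.1 fun j hj => key j P hj hmP

theorem exists_comap_eq_of_conductor {a : R} (hf : Function.Injective f)
    (ha : ∀ x, f a * x ∈ f.range) (p : PrimeSpectrum R) (hap : a ∉ p.asIdeal) :
    ∃ q : PrimeSpectrum S, f a ∉ q.asIdeal ∧ PrimeSpectrum.comap f q = p := by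
  have hmem : ∀ r, (∃ b ∈ p.asIdeal, f b = f a * f r) ↔ r ∈ p.asIdeal := fun r => by
    refine ⟨?_, fun hr => ⟨a * r, Ideal.mul_mem_left _ _ hr, map_mul f a r⟩⟩
    rintro ⟨b, hb, hbr⟩
    rw [← map_mul, hf.eq_iff] at hbr
    exact (p.isPrime.mem_or_mem (hbr ▸ hb)).resolve_left hap
  let q : Ideal S :=
    { carrier := {x | ∃ b ∈ p.asIdeal, f b = f a * x}
      add_mem' := by
        rintro x y ⟨b, hb, hbx⟩ ⟨c, hc, hcy⟩
        exact ⟨b + c, add_mem hb hc, by rw [map_add, hbx, hcy, mul_add]⟩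
      zero_mem' := ⟨0, zero_mem _, by simp⟩
      smul_mem' := by
        rintro y x ⟨b, hb, hbx⟩
        obtain ⟨c, hc⟩ := ha y
        obtain ⟨d, hd⟩ := ha (y * x)
        have h1 : a * d = c * b := hf (by rw [map_mul, map_mul, hd, hc, hbx]; ring)
        exact ⟨d, (p.isPrime.mem_or_mem (h1 ▸ Ideal.mul_mem_left _ c hb)).resolve_left hap, hd⟩ }
  have hq : q.IsPrime := by
    refine ⟨fun h => ?_, ?_⟩
    · have : f 1 ∈ q := h ▸ Submodule.mem_top
      exact p.isPrime.ne_top ((Ideal.eq_top_iff_one _).2 ((hmem 1).1 this))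
    · rintro x y ⟨b, hb, hbxy⟩
      obtain ⟨c, hc⟩ := ha x
      obtain ⟨d, hd⟩ := ha y
      have h1 : c * d = a * b := hf (by rw [map_mul, map_mul, hc, hd, hbxy]; ring)
      rcases p.isPrime.mem_or_mem (h1 ▸ Ideal.mul_mem_left _ a hb) with h | h
      · exact Or.inl ⟨c, h, hc⟩
      · exact Or.inr ⟨d, h, hd⟩
  exact ⟨⟨q, hq⟩, fun h => hap ((hmem a).1 h), by ext r; exact hmem r⟩

end Conductor

theorem height_add_card_le_height_comap_aeval {σ T : Type*} [Fintype σ] [CommRing T] (s : σ → T)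
    (q : PrimeSpectrum T) :
    height q + Fintype.card σ ≤
      height (PrimeSpectrum.comap (MvPolynomial.aeval s : MvPolynomial σ T →ₐ[T] T).toRingHom q) := by
  have hmem : ∀ (c : T ⧸ q.asIdeal) (B : Subalgebra T (T ⧸ q.asIdeal)), c ∈ B := fun c B => by
    obtain ⟨t, rfl⟩ := Ideal.Quotient.mk_surjective c
    exact B.algebraMap_mem t
  have hcomp : ∀ f : MvPolynomial σ T,
      MvPolynomial.aeval (fun i => Ideal.Quotient.mk q.asIdeal (s i)) f =
        Ideal.Quotient.mk q.asIdeal (MvPolynomial.aeval s f) := fun f => by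
    rw [← Ideal.Quotient.mkₐ_eq_mk T, ← AlgHom.comp_apply, MvPolynomial.comp_aeval]
  have h := height_primeExt_add_card_le (fun i => Ideal.Quotient.mk q.asIdeal (s i))
    (PrimeSpectrum.comap (MvPolynomial.aeval s : MvPolynomial σ T →ₐ[T] T).toRingHom q)
    (fun f => by rw [hcomp, Ideal.Quotient.eq_zero_iff_mem]; rfl) q
    (fun a ha => Ideal.Quotient.eq_zero_iff_mem.2 ha) ∅
    fun i _ => ⟨Polynomial.X - Polynomial.C (Ideal.Quotient.mk q.asIdeal (s i)),
      Polynomial.X_sub_C_ne_zero _, fun e => hmem _ _, by simp⟩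
  rw [Finset.card_empty, Nat.cast_zero, add_zero] at h
  refine le_trans ?_ h
  gcongr
  exact height_le_height_apply_of_strictMono _ (primeExt_strictMono σ T) q

section Pullback

variable {k T : Type*} [Field k] [CommRing T] [Algebra k T] {M : Ideal T}

/-- The restriction of the canonical surjection `T → T/M` to the inverse image of `D`. -/
def pullbackHom (D : Subalgebra k (T ⧸ M)) : D.comap (Ideal.Quotient.mkₐ k M) →ₐ[k] D :=
  ((Ideal.Quotient.mkₐ k M).comp (D.comap (Ideal.Quotient.mkₐ k M)).val).codRestrict D
    fun a => a.2

variable (D : Subalgebra k (T ⧸ M))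

theorem pullbackHom_surjective : Function.Surjective (pullbackHom D) := by
  rintro ⟨d, hd⟩
  obtain ⟨t, rfl⟩ := Ideal.Quotient.mk_surjective d
  exact ⟨⟨t, hd⟩, rfl⟩

theorem pullbackHom_eq_zero {a : D.comap (Ideal.Quotient.mkₐ k M)} :
    pullbackHom D a = 0 ↔ (a : T) ∈ M := by
  rw [← Ideal.Quotient.eq_zero_iff_mem, Subtype.ext_iff]
  rfl

theorem mem_pullback_of_mem {t : T} (ht : t ∈ M) : t ∈ D.comap (Ideal.Quotient.mkₐ k M) := by
  change Ideal.Quotient.mk M t ∈ D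
  rw [Ideal.Quotient.eq_zero_iff_mem.2 ht]
  exact D.zero_mem

theorem C_mul_mem_range_map {σ : Type*} {m : T} (hm : m ∈ M) (f : MvPolynomial σ T) :
    MvPolynomial.C m * f ∈ (MvPolynomial.map (σ := σ)
      (D.comap (Ideal.Quotient.mkₐ k M)).val.toRingHom).range := by
  induction f using MvPolynomial.induction_on with
  | C a =>
    exact ⟨MvPolynomial.C ⟨m * a, mem_pullback_of_mem D (Ideal.mul_mem_right _ _ hm)⟩, by simp⟩
  | add p q hp hq => rw [mul_add]; exact add_mem hp hq
  | mul_X p i hp => rw [← mul_assoc]; exact mul_mem hp ⟨MvPolynomial.X i, by simp⟩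

theorem height_add_card_le_height_primeExt {σ : Type*} [Fintype σ] [IsDomain T] (hM0 : M ≠ ⊥)
    (hM : M.IsPrime) (t : σ → T ⧸ M) (ht : AlgebraicIndependent D t)
    (N : PrimeSpectrum (D.comap (Ideal.Quotient.mkₐ k M))) (hN : ∀ a, a ∈ N.asIdeal ↔ (a : T) ∈ M) :
    height (⟨M, hM⟩ : PrimeSpectrum T) + Fintype.card σ ≤ height (primeExt σ N) := by
  obtain ⟨s, rfl⟩ : ∃ s : σ → T, (fun i => Ideal.Quotient.mk M (s i)) = t :=
    ⟨fun i => (Ideal.Quotient.mk_surjective (t i)).choose,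
      funext fun i => (Ideal.Quotient.mk_surjective (t i)).choose_spec⟩
  let g := (MvPolynomial.aeval s : MvPolynomial σ T →ₐ[T] T).toRingHom
  let j := MvPolynomial.map (σ := σ) (D.comap (Ideal.Quotient.mkₐ k M)).val.toRingHom
  have hg : StrictMono (PrimeSpectrum.comap g) := by
    intro q q' hqq'
    refine lt_of_le_not_ge (Ideal.comap_mono hqq'.le) fun h => hqq'.not_ge fun a ha => ?_
    have : MvPolynomial.C a ∈ (PrimeSpectrum.comap g q).asIdeal := h (by
      change g (MvPolynomial.C a) ∈ q'.asIdeal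
      simpa [g] using ha)
    change g (MvPolynomial.C a) ∈ q.asIdeal at this
    simpa [g] using this
  have hle : PrimeSpectrum.comap j (PrimeSpectrum.comap g ⟨M, hM⟩) ≤ primeExt σ N := by
    intro f hf
    have hf' : g (j f) ∈ M := hf
    have h1 : MvPolynomial.map (pullbackHom D).toRingHom f = 0 := by
      apply ht
      rw [map_zero, ← Ideal.Quotient.eq_zero_iff_mem.2 hf']
      have : ((MvPolynomial.aeval fun i => Ideal.Quotient.mk M (s i) :
          MvPolynomial σ D →ₐ[D] T ⧸ M).toRingHom.comp
            (MvPolynomial.map (pullbackHom D).toRingHom)) =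
          (Ideal.Quotient.mk M).comp (g.comp j) := by
        apply MvPolynomial.ringHom_ext
        · intro a
          simp [g, j]
          rfl
        · intro i
          simp [g, j]
      exact congrArg (fun φ => φ f) this
    refine mem_primeExt.2 fun e => ?_
    rw [hN, ← pullbackHom_eq_zero]
    have := congrArg (MvPolynomial.coeff e) h1
    rwa [MvPolynomial.coeff_map] at this
  have key : ∀ q : PrimeSpectrum T, q < ⟨M, hM⟩ →
      height q + 1 + Fintype.card σ ≤ height (primeExt σ N) := by
    intro q hq
    obtain ⟨m, hm, hmq⟩ := SetLike.exists_of_lt (show q.asIdeal < M from hq)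
    have hmq' : MvPolynomial.C m ∉ (PrimeSpectrum.comap g q).asIdeal := by
      change ¬ g (MvPolynomial.C m) ∈ q.asIdeal
      simpa [g] using hmq
    calc height q + 1 + Fintype.card σ = height q + Fintype.card σ + 1 := add_right_comm _ _ _
      _ ≤ height (PrimeSpectrum.comap g q) + 1 := by
        gcongr
        exact height_add_card_le_height_comap_aeval s q
      _ ≤ height (PrimeSpectrum.comap j (PrimeSpectrum.comap g q)) + 1 := by
        gcongr
        exact height_le_height_comap_of_conductor (C_mul_mem_range_map D hm) _ hmq'
      _ ≤ height (PrimeSpectrum.comap j (PrimeSpectrum.comap g ⟨M, hM⟩)) :=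
        height_add_one_le (comap_lt_comap_of_conductor (C_mul_mem_range_map D hm) (hg hq) hmq')
      _ ≤ _ := height_mono hle
  have hne : Nonempty {q : PrimeSpectrum T // q < ⟨M, hM⟩} :=
    ⟨⟨⊥, Ideal.isPrime_bot⟩, (bot_lt_iff_ne_bot.2 hM0 : (⊥ : Ideal T) < M)⟩
  rw [height_eq_iSup_lt_height, iSup_subtype', ENat.iSup_add]
  exact iSup_le fun q => key q q.2

end Pullback

theorem trdeg_le_of_conductor (k : Type*) {B L : Type u} [Field k] [CommRing B] [CommRing L]
    [IsDomain L] [Algebra k B] [Algebra k L] [Algebra B L] [IsScalarTower k B L] [FaithfulSMul B L]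
    {b : B} (hb : b ≠ 0) (hbL : ∀ y : L, algebraMap B L b * y ∈ (algebraMap B L).range) :
    Algebra.trdeg k L ≤ Algebra.trdeg k B := by
  have : Nontrivial B := ⟨b, 0, hb⟩
  have : Algebra.IsAlgebraic B L := ⟨fun y => by
    obtain ⟨c, hc⟩ := hbL y
    refine ⟨Polynomial.C b * Polynomial.X - Polynomial.C c, fun h => hb ?_, by simp [hc]⟩
    simpa using congrArg (Polynomial.coeff · 1) h⟩
  rw [← trdeg_add_eq (R := k) (S := B) (A := L), trdeg_eq_zero (R := B), add_zero]

section Pullback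

variable {k T : Type u} [Field k] [CommRing T] [IsDomain T] [Algebra k T] {M : Ideal T}
  (D : Subalgebra k (T ⧸ M))

theorem trdeg_pullback_le_of_notMem (hT : IsAFDomain k T) {m : T} (hm : m ∈ M)
    (p : PrimeSpectrum (D.comap (Ideal.Quotient.mkₐ k M)))
    (hmp : ⟨m, mem_pullback_of_mem D hm⟩ ∉ p.asIdeal) :
    Cardinal.toENat (Algebra.trdeg k (D.comap (Ideal.Quotient.mkₐ k M))) ≤
      height p +
        Cardinal.toENat (Algebra.trdeg k (D.comap (Ideal.Quotient.mkₐ k M) ⧸ p.asIdeal)) := by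
  let A := D.comap (Ideal.Quotient.mkₐ k M)
  let a : A := ⟨m, mem_pullback_of_mem D hm⟩
  have hcond : ∀ x : T, algebraMap A T a * x ∈ (algebraMap A T).range := fun x =>
    ⟨⟨m * x, mem_pullback_of_mem D (Ideal.mul_mem_right _ _ hm)⟩, rfl⟩
  obtain ⟨q, haq, hqp⟩ :=
    exists_comap_eq_of_conductor (FaithfulSMul.algebraMap_injective A T) hcond p hmp
  have : q.asIdeal.LiesOver p.asIdeal := ⟨by rw [← hqp]; rfl⟩
  have h1 := height_le_height_comap_of_conductor hcond q haq
  rw [hqp] at h1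
  have h2 : Algebra.trdeg k (T ⧸ q.asIdeal) ≤ Algebra.trdeg k (A ⧸ p.asIdeal) := by
    refine trdeg_le_of_conductor k (b := Ideal.Quotient.mk p.asIdeal a)
      (fun h => hmp (Ideal.Quotient.eq_zero_iff_mem.1 h)) fun y => ?_
    obtain ⟨x, rfl⟩ := Ideal.Quotient.mk_surjective y
    obtain ⟨c, hc⟩ := hcond x
    refine ⟨Ideal.Quotient.mk _ c, ?_⟩
    rw [Ideal.Quotient.algebraMap_mk_of_liesOver, Ideal.Quotient.algebraMap_mk_of_liesOver, hc,
      map_mul]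
  have h3 := hT q.asIdeal q.isPrime
  rw [eTrdeg_eq, eTrdeg_eq, idealHt_eq_height] at h3
  calc _ ≤ Cardinal.toENat (Algebra.trdeg k T) :=
        OrderHomClass.mono Cardinal.toENat (trdeg_le_of_injective A.val Subtype.val_injective)
    _ ≤ _ := h3 ▸ add_le_add h1 (OrderHomClass.mono Cardinal.toENat h2)

theorem trdeg_pullback_le_of_le {σ : Type u} [Fintype σ] [hM : M.IsMaximal] (hT : IsAFDomain k T)
    (hD : IsAFDomain k D) (t : σ → T ⧸ M) (ht : IsTranscendenceBasis D t)
    (p : PrimeSpectrum (D.comap (Ideal.Quotient.mkₐ k M)))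
    (hp : ∀ a : D.comap (Ideal.Quotient.mkₐ k M), (a : T) ∈ M → a ∈ p.asIdeal) :
    Cardinal.toENat (Algebra.trdeg k (D.comap (Ideal.Quotient.mkₐ k M))) ≤
      height (primeExt σ p) +
        Cardinal.toENat (Algebra.trdeg k (D.comap (Ideal.Quotient.mkₐ k M) ⧸ p.asIdeal)) := by
  let A := D.comap (Ideal.Quotient.mkₐ k M)
  let π := pullbackHom D
  have hπ : Function.Surjective π := pullbackHom_surjective D
  have hker : RingHom.ker π ≤ p.asIdeal := fun a ha => hp a ((pullbackHom_eq_zero D).1 ha)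
  let N : PrimeSpectrum A := ⟨RingHom.ker π, RingHom.ker_isPrime π⟩
  let q : PrimeSpectrum D := ⟨p.asIdeal.map π, Ideal.map_isPrime_of_surjective hπ hker⟩
  have hpq : PrimeSpectrum.comap π.toRingHom q = p := by
    ext1
    exact (Ideal.comap_map_of_surjective π.toRingHom hπ p.asIdeal).trans (sup_eq_left.2 hker)
  have hq := hD q.asIdeal q.isPrime
  rw [eTrdeg_eq, eTrdeg_eq, idealHt_eq_height] at hq
  have hmono : StrictMono fun q => primeExt σ (PrimeSpectrum.comap π.toRingHom q) :=
    (primeExt_strictMono σ A).comp fun q q' hqq' =>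
      lt_of_le_not_ge (Ideal.comap_mono hqq'.le) fun h => hqq'.not_ge
        ((Ideal.comap_le_comap_iff_of_surjective π.toRingHom hπ _ _).1 h)
  have h1 := height_add_height_le hmono (b := primeExt σ N)
    (fun q => (primeExt_strictMono σ A).monotone (Ideal.comap_mono (bot_le : ⊥ ≤ q.asIdeal))) q
  simp only [hpq] at h1
  have h2 : Algebra.trdeg k (D ⧸ q.asIdeal) ≤ Algebra.trdeg k (A ⧸ p.asIdeal) :=
    trdeg_le_of_surjective (Ideal.quotientMapₐ q.asIdeal π Ideal.le_comap_map)
      (Ideal.quotientMap_surjective (H := Ideal.le_comap_map) hπ)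
  have h3 : Cardinal.toENat (Algebra.trdeg k A) ≤
      height (primeExt σ N) + Cardinal.toENat (Algebra.trdeg k D) := by
    by_cases hM0 : M = ⊥
    · have hinj : Function.Injective π := (injective_iff_map_eq_zero π).2 fun a ha =>
        Subtype.ext (Ideal.mem_bot.1 (hM0.le ((pullbackHom_eq_zero D).1 ha)))
      exact (OrderHomClass.mono Cardinal.toENat (trdeg_le_of_injective π hinj)).trans le_add_self
    · have h4 := height_add_card_le_height_primeExt D hM0 hM.isPrime t ht.1 N
        fun a => pullbackHom_eq_zero D
      have : FaithfulSMul k D :=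
        (faithfulSMul_iff_algebraMap_injective k D).2 (algebraMap k D).injective
      have h5 := hT M hM.isPrime
      rw [eTrdeg_eq, eTrdeg_eq, idealHt_eq_height ⟨M, hM.isPrime⟩,
        ← trdeg_add_eq (R := k) (S := D) (A := T ⧸ M), map_add, ← ht.cardinalMk_eq_trdeg,
        Cardinal.mk_fintype, map_natCast] at h5
      calc _ ≤ Cardinal.toENat (Algebra.trdeg k T) :=
            OrderHomClass.mono Cardinal.toENat (trdeg_le_of_injective A.val Subtype.val_injective)
        _ = height (⟨M, hM.isPrime⟩ : PrimeSpectrum T) + Fintype.card σ +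
              Cardinal.toENat (Algebra.trdeg k D) := by rw [← h5]; ring
        _ ≤ _ := by gcongr
  calc _ ≤ height (primeExt σ N) + Cardinal.toENat (Algebra.trdeg k D) := h3
    _ = height q + height (primeExt σ N) + Cardinal.toENat (Algebra.trdeg k (D ⧸ q.asIdeal)) := by
      rw [← hq]; ring
    _ ≤ _ := add_le_add h1 (OrderHomClass.mono Cardinal.toENat h2)

end Pullback

/-- For the pullback `A = φ⁻¹(D)` of a proper subring `D` of `K = T/M`
along the canonical surjection `φ : T → K`, with `T` and `D` AF-domains, the polynomial
ring `A[X_1, ..., X_{t.d.(K:D)}]` is an AF-domain. -/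
theorem stmt_2 (k T : Type) [Field k] [CommRing T] [IsDomain T] [Algebra k T]
    (hTfin : eTrdeg k T ≠ ⊤)
    (M : Ideal T) [hM : M.IsMaximal]
    (D : Subalgebra k (T ⧸ M)) (hDproper : D ≠ ⊤)
    (A : Subalgebra k T) (hA : A = D.comap (Ideal.Quotient.mkₐ k M))
    (hTAF : IsAFDomain k T) (hDAF : IsAFDomain k ↥D)
    (n : ℕ) (hn : eTrdeg (↥D) (T ⧸ M) = n) :
    IsAFDomain k (MvPolynomial (Fin n) ↥A) := by
  subst hA
  have := hM.isPrime
  obtain ⟨ι, t, ht⟩ := exists_isTranscendenceBasis' D (T ⧸ M)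
  rw [eTrdeg_eq, ← ht.cardinalMk_eq_trdeg, Cardinal.toENat_eq_natCast] at hn
  obtain ⟨e⟩ : Nonempty (Fin n ≃ ι) := Cardinal.eq.1 (by simpa using hn.symm)
  refine isAFDomain_mvPolynomial fun p => ?_
  by_cases hp : ∀ a : D.comap (Ideal.Quotient.mkₐ k M), (a : T) ∈ M → a ∈ p.asIdeal
  · exact trdeg_pullback_le_of_le D hTAF hDAF (t ∘ e) (ht.comp_equiv e) p hp
  · push Not at hp
    obtain ⟨a, ha, hap⟩ := hp
    refine (trdeg_pullback_le_of_notMem D hTAF ha p hap).trans ?_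
    gcongr
    exact height_le_height_apply_of_strictMono _ (primeExt_strictMono (Fin n) _) p
end
end

section
/- Let A and B be k-algebras of finite transcendence degree over k such that A is an AF-domain. Let P be a prime ideal of A⊗_kB and q = P∩B. Then ht(P) = ht(A⊗_kq) + ht(P/(A⊗_kq)), where P/(A⊗_kq) denotes the image of P in (A⊗_kB)/(A⊗_kq); moreover ht(A⊗_kq) = ht(q[t.d.(A)]), the height of the extension of q to the polynomial ring B[X_1,...,X_{t.d.(A)}]. -/
open TensorProduct

noncomputable section

open Ideal in
theorem Ideal.height_comap_le_of_flat {R S : Type*} [CommRing R] [CommRing S] {f : R →+* S}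
    (hf : f.Flat) (Q : Ideal S) [hQ : Q.IsPrime] : (Q.comap f).height ≤ Q.height := by
  suffices H : ∀ (n : ℕ) (Q : Ideal S), Q.IsPrime → Q.height ≤ n → (Q.comap f).height ≤ n by
    cases h : Q.height with
    | top => exact le_top
    | coe n => exact H n Q hQ h.le
  algebraize [f]
  intro n
  induction n with
  | zero =>
    intro Q hQ h
    rw [height_le_iff] at h ⊢
    intro p hp hlt
    have : Q.LiesOver (Q.comap f) := ⟨rfl⟩
    obtain ⟨Q', hlt', hQ', hl⟩ := exists_ideal_lt_liesOver_of_lt (S := S) Q hlt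
    exact absurd (h Q' hQ' hlt') (by simp)
  | succ n ih =>
    intro Q hQ h
    rw [height_le_iff] at h ⊢
    intro p hp hlt
    have : Q.LiesOver (Q.comap f) := ⟨rfl⟩
    obtain ⟨Q', hlt', hQ', hl⟩ := exists_ideal_lt_liesOver_of_lt (S := S) Q hlt
    have h1 := h Q' hQ' hlt'
    push_cast at h1 ⊢
    have h2 := ih Q' hQ' (ENat.lt_natCast_add_one_iff.mp h1)
    rw [hl.over]
    exact ENat.lt_natCast_add_one_iff.mpr h2

/-- Flat extension does not decrease heights. -/
theorem Ideal.height_le_height_map_of_flat {R S : Type*} [CommRing R] [CommRing S] {f : R →+* S}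
    (hf : f.Flat) (I : Ideal R) : I.height ≤ (I.map f).height := by
  rw [Ideal.height_eq_inf_minimalPrimes (I.map f)]
  refine le_iInf₂ fun J hJ ↦ ?_
  have := hJ.1.1
  exact (Ideal.height_mono (Ideal.map_le_iff_le_comap.mp hJ.1.2)).trans
    (Ideal.height_comap_le_of_flat hf J)

theorem Ideal.exists_lt_le_height_of_add_one_le_height {R : Type*} [CommRing R] {P : Ideal R}
    [P.IsPrime] {n : ℕ} (h : (n : ℕ∞) + 1 ≤ P.height) :
    ∃ Q : Ideal R, Q.IsPrime ∧ Q < P ∧ (n : ℕ∞) ≤ Q.height := by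
  have : ¬ P.height ≤ n := by
    rw [not_le]
    refine lt_of_lt_of_le ?_ h
    exact_mod_cast n.lt_succ_self
  rw [Ideal.height_le_iff] at this
  push Not at this
  exact this

theorem Ideal.height_add_height_map_le_of_surjective {R S : Type*} [CommRing R] [CommRing S]
    {f : R →+* S} (hf : Function.Surjective f) (P : Ideal R) [hP : P.IsPrime]
    (hker : RingHom.ker f ≤ P) :
    (RingHom.ker f).height + (P.map f).height ≤ P.height := by
  have hcomap : (P.map f).comap f = P := by
    rw [Ideal.comap_map_of_surjective f hf, ← RingHom.ker_eq_comap_bot, sup_eq_left.mpr hker]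
  have hprime : (P.map f).IsPrime := Ideal.map_isPrime_of_surjective hf hker
  suffices H : ∀ (n : ℕ) (Q : Ideal S), Q.IsPrime → (n : ℕ∞) ≤ Q.height →
      (RingHom.ker f).height + n ≤ (Q.comap f).height by
    rw [← hcomap]
    conv_lhs => rw [hcomap]
    cases h : (P.map f).height with
    | coe n => exact H n _ hprime h.ge
    | top =>
      rw [add_top, top_le_iff, ENat.eq_top_iff_forall_ge]
      exact fun n ↦ le_add_self.trans (H n _ hprime (h ▸ le_top))
  intro n
  induction n with
  | zero =>
    intro Q hQ _
    simpa using Ideal.height_mono (Ideal.ker_le_comap f)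
  | succ n ih =>
    intro Q hQ h
    push_cast at h
    obtain ⟨Q', hQ', hlt, hn⟩ := Ideal.exists_lt_le_height_of_add_one_le_height h
    have := ih Q' hQ' hn
    have hlt' : Q'.comap f < Q.comap f :=
      lt_of_le_of_ne (Ideal.comap_mono hlt.le)
        fun h ↦ hlt.ne (Ideal.comap_injective_of_surjective f hf h)
    push_cast
    rw [← add_assoc]
    exact le_trans (by gcongr) (Ideal.height_add_one_le_of_lt_of_isPrime hlt')

/-- The infimum of heights over all primes containing `I` is Mathlib's height. -/
theorem idealHt_eq_height_s5 {R : Type*} [CommRing R] (I : Ideal R) : idealHt I = I.height := by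
  apply le_antisymm
  · rw [Ideal.height_eq_inf_minimalPrimes]
    refine le_iInf₂ fun J hJ ↦ ?_
    have := hJ.1.1
    change _ ≤ (PrimeSpectrum.mk J this).asIdeal.height
    rw [PrimeSpectrum.height_eq_orderHeight]
    exact iInf_le (fun P : { P : PrimeSpectrum R // I ≤ P.asIdeal } ↦ Order.height P.1)
      ⟨⟨J, hJ.1.1⟩, hJ.1.2⟩
  · refine le_iInf fun P ↦ ?_
    rw [← PrimeSpectrum.height_eq_orderHeight]
    exact Ideal.height_mono P.2

theorem Polynomial.comap_C_map_C {R : Type*} [CommRing R] (I : Ideal R) :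
    (I.map C : Ideal (Polynomial R)).comap C = I := by
  refine le_antisymm (fun x hx ↦ ?_) Ideal.le_comap_map
  simpa using Ideal.mem_map_C_iff.mp hx 0

/-- Of two comparable distinct primes of `R[X]` with the same contraction to `R`, the smaller is
extended from `R`. -/
theorem Polynomial.eq_map_C_of_lt_of_comap_eq {R : Type*} [CommRing R]
    {P Q : Ideal (Polynomial R)} [hP : P.IsPrime] [hQ : Q.IsPrime] (hlt : Q < P)
    (h : Q.comap C = P.comap C) : Q = (P.comap C).map C := by
  by_contra hne
  let p : PrimeSpectrum R := ⟨P.comap C, inferInstance⟩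
  have hprime : ((P.comap C).map C : Ideal (Polynomial R)).IsPrime :=
    Ideal.isPrime_map_C_of_isPrime
  have hle : (P.comap C).map C < Q :=
    lt_of_le_of_ne (Ideal.map_le_iff_le_comap.mpr h.ge) (Ne.symm hne)
  have hcomap : ((P.comap C).map C : Ideal (Polynomial R)).comap C = P.comap C :=
    comap_C_map_C _
  let F := PrimeSpectrum.comap (algebraMap R (Polynomial R)) ⁻¹' {p}
  let a : F := ⟨⟨_, hprime⟩, PrimeSpectrum.ext hcomap⟩
  let b : F := ⟨⟨Q, hQ⟩, PrimeSpectrum.ext h⟩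
  let c : F := ⟨⟨P, hP⟩, rfl⟩
  have hab : a < b := hle
  have hbc : b < c := hlt
  have hdim : Order.krullDim F ≤ 1 := by
    rw [Order.krullDim_eq_of_orderIso
      (PrimeSpectrum.preimageOrderIsoFiber R (Polynomial R) p), ← ringKrullDim,
      ← ringKrullDim_eq_of_ringEquiv (polyEquivTensor R (p.asIdeal.ResidueField)).toRingEquiv]
    exact (Ring.krullDimLE_iff (n := 1)).mp inferInstance
  have h1 : 1 + 1 ≤ Order.height c :=
    (add_le_add_left (le_add_self.trans (Order.height_add_one_le hab)) 1).trans
      (Order.height_add_one_le hbc)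
  have h2 : ((1 + 1 : ℕ∞) : WithBot ℕ∞) ≤ (1 : ℕ∞) :=
    (WithBot.coe_le_coe.mpr h1).trans ((Order.height_le_krullDim c).trans hdim)
  exact absurd (WithBot.coe_le_coe.mp h2) (by decide)

theorem Polynomial.height_le_height_map_comap_C_add_one {R : Type*} [CommRing R]
    (P : Ideal (Polynomial R)) [hP : P.IsPrime] :
    P.height ≤ ((P.comap C).map C : Ideal (Polynomial R)).height + 1 := by
  have hprime (Q : Ideal (Polynomial R)) [Q.IsPrime] :
      ((Q.comap C).map C : Ideal (Polynomial R)).IsPrime :=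
    Ideal.isPrime_map_C_of_isPrime
  suffices H : ∀ (n : ℕ) (P : Ideal (Polynomial R)), P.IsPrime →
      ((P.comap C).map C : Ideal (Polynomial R)).height ≤ n → P.height ≤ (n + 1 : ℕ) by
    cases h : ((P.comap C).map C : Ideal (Polynomial R)).height with
    | top => simp
    | coe n => exact_mod_cast H n P hP h.le
  intro n
  induction n using Nat.strong_induction_on with
  | h n ih =>
    intro P hP h
    rw [Ideal.height_le_iff]
    intro Q hQ hlt
    rcases (Ideal.comap_mono (f := C) hlt.le).eq_or_lt with heq | hlt'
    · rw [eq_map_C_of_lt_of_comap_eq hlt heq]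
      exact lt_of_le_of_lt h (by exact_mod_cast n.lt_succ_self)
    · rw [Ideal.height_le_iff] at h
      have hm := h _ (hprime Q) (lt_of_le_of_ne (Ideal.map_mono hlt'.le)
        fun he ↦ hlt'.ne (by rw [← comap_C_map_C (Q.comap C), he, comap_C_map_C]))
      obtain ⟨m, hm'⟩ := ENat.ne_top_iff_exists.mp (ne_top_of_lt hm)
      rw [← hm', Nat.cast_lt] at hm
      refine lt_of_le_of_lt (ih m hm Q hQ hm'.ge) ?_
      exact_mod_cast Nat.succ_lt_succ hm

theorem MvPolynomial.comap_C_map_C {R σ : Type*} [CommRing R] (I : Ideal R) :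
    (I.map C : Ideal (MvPolynomial σ R)).comap C = I := by
  refine le_antisymm (fun x hx ↦ ?_) Ideal.le_comap_map
  simpa using MvPolynomial.mem_map_C_iff.mp hx 0

/-- The isomorphism `R[X][σ] ≃ R[σ][X]`. -/
def MvPolynomial.swapPolynomialEquiv (R σ : Type*) [CommRing R] :
    MvPolynomial σ (Polynomial R) ≃+* Polynomial (MvPolynomial σ R) :=
  (optionEquivRight R σ).symm.toRingEquiv.trans (optionEquivLeft R σ).toRingEquiv

theorem MvPolynomial.swapPolynomialEquiv_comp_C (R σ : Type*) [CommRing R] :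
    (swapPolynomialEquiv R σ).toRingHom.comp C = Polynomial.mapRingHom (C (σ := σ)) := by
  ext r <;> simp [swapPolynomialEquiv]

theorem Polynomial.comap_mapRingHom_map_C {R S : Type*} [CommRing R] [CommRing S] (f : R →+* S)
    (I : Ideal S) :
    (I.map C : Ideal (Polynomial S)).comap (mapRingHom f) = (I.comap f).map C := by
  ext p
  simp [Ideal.mem_map_C_iff]

theorem Ideal.height_map_of_ringEquiv_comp {R S T : Type*} [CommRing R] [CommRing S] [CommRing T]
    (e : S ≃+* T) {f : R →+* S} {g : R →+* T} (h : (e : S →+* T).comp f = g) (I : Ideal R) :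
    (I.map g).height = (I.map f).height := by
  rw [← h, ← Ideal.map_map]
  exact e.height_map _

theorem MvPolynomial.height_le_height_map_comap_C_add_card (σ : Type*) [Finite σ] {R : Type*}
    [CommRing R] (P : Ideal (MvPolynomial σ R)) [hP : P.IsPrime] :
    P.height ≤ ((P.comap C).map C : Ideal (MvPolynomial σ R)).height + Nat.card σ := by
  induction σ using Finite.induction_empty_option generalizing R with
  | of_equiv e H =>
    let e' := (renameEquiv R e).toRingEquiv
    have h1 := H (P.comap e')
    have hC : (P.comap e').comap C = P.comap C := by
      ext r
      simp [Ideal.mem_comap, e']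
    rw [RingEquiv.height_comap, hC, Nat.card_congr e] at h1
    rwa [Ideal.height_map_of_ringEquiv_comp e' (f := C) (by ext; simp [e'])]
  | h_empty =>
    have : (P.comap C).map C = P := Ideal.map_comap_of_surjective _ (C_surjective PEmpty) P
    rw [this]
    exact le_self_add
  | @h_option σ _ IH =>
    let e := (optionEquivLeft R σ).toRingEquiv
    let s := swapPolynomialEquiv R σ
    let P' : Ideal (Polynomial (MvPolynomial σ R)) := P.comap e.symm
    have hQ : ((P'.comap Polynomial.C).map Polynomial.C :
        Ideal (Polynomial (MvPolynomial σ R))).IsPrime := Ideal.isPrime_map_C_of_isPrime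
    have h1 := Polynomial.height_le_height_map_comap_C_add_one P'
    have h2 := IH (((P'.comap Polynomial.C).map Polynomial.C).comap s)
    have hC : (((P'.comap Polynomial.C).map Polynomial.C).comap s).comap C =
        (P.comap C).map Polynomial.C := by
      refine (congrArg
        (fun f ↦ Ideal.comap f ((P'.comap Polynomial.C).map Polynomial.C))
        (swapPolynomialEquiv_comp_C R σ)).trans ?_
      rw [Polynomial.comap_mapRingHom_map_C]
      congr 1
      ext r
      have hr : e.symm (Polynomial.C (C r)) = C r := by
        rw [RingEquiv.symm_apply_eq]
        simp [e]
      change e.symm (Polynomial.C (C r)) ∈ P ↔ C r ∈ P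
      rw [hr]
    rw [RingEquiv.height_comap] at h1 h2
    rw [hC, Ideal.map_map, ← Ideal.height_map_of_ringEquiv_comp
      (s.trans e.symm) (f := C.comp Polynomial.C) (g := C)
      (by ext r : 1; simp [s, e, swapPolynomialEquiv, optionEquivRight_symm_apply])] at h2
    rw [Finite.card_option, Nat.cast_add, Nat.cast_one, ← add_assoc]
    exact h1.trans (by gcongr)

/-- If the variables indexed by `T` stay independent over `R / (P ∩ R)` modulo the prime `P`, only
the remaining variables contribute to the height of `P`. -/
theorem MvPolynomial.height_le_height_map_add_card_compl {σ R : Type*} [Finite σ] [CommRing R]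
    (P : Ideal (MvPolynomial σ R)) [hP : P.IsPrime] (q : Ideal R) (T : Set σ)
    (hT : P.comap (rename ((↑) : T → σ) : MvPolynomial T R →ₐ[R] MvPolynomial σ R) = q.map C) :
    P.height ≤ (q.map C : Ideal (MvPolynomial σ R)).height + Nat.card (Tᶜ : Set σ) := by
  classical
  let e := ((renameEquiv R ((Equiv.sumComm _ _).trans (Equiv.Set.sumCompl T))).symm.trans
    (sumAlgEquiv R (Tᶜ : Set σ) T)).symm.toRingEquiv
  have he (f : MvPolynomial T R) : e (C f) = rename ((↑) : T → σ) f := by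
    have : e.toRingHom.comp C = (rename ((↑) : T → σ) :
        MvPolynomial T R →ₐ[R] MvPolynomial σ R).toRingHom := by
      ext <;> simp [e]
    exact congrArg (fun g : _ →+* _ ↦ g f) this
  have h1 := height_le_height_map_comap_C_add_card _ (P.comap e)
  have hC : (P.comap e).comap C = q.map C := by
    rw [← hT]
    ext f
    simp [Ideal.mem_comap, he]
  rw [RingEquiv.height_comap, hC, Ideal.map_map] at h1
  rwa [Ideal.height_map_of_ringEquiv_comp e (f := C.comp C) (by ext r; simp [he])]

theorem Polynomial.flat_C {R : Type*} [CommRing R] : (C : R →+* Polynomial R).Flat :=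
  RingHom.flat_algebraMap_iff.mpr (inferInstanceAs (Module.Flat R (Polynomial R)))

theorem MvPolynomial.exists_comap_rename_eq_bot.{u, v} {σ : Type u} {R : Type v} [Finite σ]
    [CommRing R] (P : Ideal (MvPolynomial σ R)) [hP : P.IsPrime] (hbot : P.comap C = ⊥) :
    ∃ (τ : Type u) (_ : Finite τ) (j : τ → σ), Function.Injective j ∧
      P.comap (rename j : MvPolynomial τ R →ₐ[R] MvPolynomial σ R) = ⊥ ∧
      (Nat.card σ : ℕ∞) ≤ P.height + Nat.card τ := by
  induction σ using Finite.induction_empty_option with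
  | of_equiv e H =>
    obtain ⟨τ, hτ, j, hj, hb, hc⟩ := H (P.comap (renameEquiv R e).toRingEquiv) (by
      rw [← hbot]
      ext r
      simp [Ideal.mem_comap])
    refine ⟨τ, hτ, e ∘ j, e.injective.comp hj, ?_, ?_⟩
    · rw [← hb]
      ext r
      simp [Ideal.mem_comap, rename_rename]
    · rwa [RingEquiv.height_comap, Nat.card_congr e] at hc
  | h_empty =>
    refine ⟨PEmpty, inferInstance, id, Function.injective_id, ?_, by simp⟩
    rw [eq_bot_iff]
    intro f hf
    obtain ⟨r, rfl⟩ := C_surjective PEmpty f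
    have : r ∈ P.comap C := by simpa using hf
    rw [hbot] at this
    simpa using this
  | @h_option σ _ IH =>
    let e := (optionEquivLeft R σ).toRingEquiv
    let P' : Ideal (Polynomial (MvPolynomial σ R)) := P.comap e.symm
    have hPP' (f) : f ∈ P ↔ optionEquivLeft R σ f ∈ P' := by
      change _ ↔ e.symm (e f) ∈ P
      rw [e.symm_apply_apply]
    have hh : P.height = P'.height := (RingEquiv.height_comap _ _).symm
    have hQ : ((P'.comap Polynomial.C).map Polynomial.C :
        Ideal (Polynomial (MvPolynomial σ R))).IsPrime := Ideal.isPrime_map_C_of_isPrime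
    have hle : (P'.comap Polynomial.C).map Polynomial.C ≤ P' := Ideal.map_comap_le
    have hflat := Ideal.height_le_height_map_of_flat Polynomial.flat_C (P'.comap Polynomial.C)
    obtain ⟨τ, hτ, j, hj, hb, hc⟩ := IH (P'.comap Polynomial.C) (by
      rw [← hbot]
      ext r
      simp [Ideal.mem_comap, hPP'])
    rcases hle.eq_or_lt with heq | hlt
    · refine ⟨Option τ, inferInstance, Option.map j, Option.map_injective hj, ?_, ?_⟩
      · rw [eq_bot_iff]
        intro f hf
        have hcomm (f : MvPolynomial (Option τ) R) : optionEquivLeft R σ (rename (Option.map j) f) =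
            Polynomial.mapRingHom (rename j : MvPolynomial τ R →ₐ[R] _).toRingHom
              (optionEquivLeft R τ f) := by
          induction f using MvPolynomial.induction_on with
          | C r => simp
          | add p q hp hq => simp only [map_add, hp, hq]
          | mul_X p i hp =>
            rw [map_mul, map_mul, hp, map_mul, map_mul]
            cases i <;> simp
        rw [Ideal.mem_comap, hPP', ← heq] at hf
        have hf' : optionEquivLeft R τ f ∈ ((P'.comap Polynomial.C).map Polynomial.C).comap
            (Polynomial.mapRingHom (rename j : MvPolynomial τ R →ₐ[R] _).toRingHom) := by
          rw [Ideal.mem_comap, ← hcomm]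
          exact hf
        rw [Polynomial.comap_mapRingHom_map_C] at hf'
        erw [hb] at hf'
        simpa using hf'
      · rw [Finite.card_option, Finite.card_option, hh]
        push_cast
        rw [← add_assoc]
        gcongr
        exact hc.trans (by rw [heq] at hflat; gcongr)
    · refine ⟨τ, hτ, some ∘ j, (Option.some_injective _).comp hj, ?_, ?_⟩
      · rw [← hb]
        ext f
        have : optionEquivLeft R σ (rename some (rename j f)) = Polynomial.C (rename j f) := by
          induction f using MvPolynomial.induction_on with
          | C r => simp
          | add p q hp hq => simp only [map_add, hp, hq]
          | mul_X p i hp =>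
            rw [map_mul, map_mul, map_mul, hp, map_mul]
            simp
        rw [Ideal.mem_comap, hPP', Ideal.mem_comap, Ideal.mem_comap, ← rename_rename]
        erw [this]
        rfl
      · rw [Finite.card_option, hh]
        push_cast
        calc (Nat.card σ : ℕ∞) + 1 ≤ (P'.comap Polynomial.C).height + Nat.card τ + 1 := by gcongr
          _ ≤ ((P'.comap Polynomial.C).map Polynomial.C).height + Nat.card τ + 1 := by gcongr
          _ = ((P'.comap Polynomial.C).map Polynomial.C).height + 1 + Nat.card τ := by ring
          _ ≤ P'.height + Nat.card τ := by
            gcongr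
            exact Ideal.height_add_one_le_of_lt_of_isPrime hlt

section tensorEval

variable {k A A' B σ : Type*} [CommRing k] [CommRing A] [CommRing A'] [CommRing B]
  [Algebra k A] [Algebra k A'] [Algebra k B]

variable (k B) in
/-- The `B`-algebra evaluation `B[σ] → A ⊗ B` at a family of elements of `A`. -/
def MvPolynomial.tensorEval (x : σ → A) : MvPolynomial σ B →+* A ⊗[k] B :=
  MvPolynomial.eval₂Hom (Algebra.TensorProduct.includeRight : B →ₐ[k] A ⊗[k] B).toRingHom
    fun i ↦ x i ⊗ₜ 1

namespace MvPolynomial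

@[simp]
theorem tensorEval_C (x : σ → A) (b : B) : tensorEval k B x (C b) = 1 ⊗ₜ b := by
  simp [tensorEval]

@[simp]
theorem tensorEval_X (x : σ → A) (i : σ) : tensorEval k B x (X i) = x i ⊗ₜ 1 := by
  simp [tensorEval]

theorem tensorEval_comp_C (x : σ → A) : (tensorEval k B x).comp C =
    (Algebra.TensorProduct.includeRight : B →ₐ[k] A ⊗[k] B).toRingHom := by
  ext; simp

theorem tensorEval_rename {τ : Type*} (x : σ → A) (j : τ → σ) (p : MvPolynomial τ B) :
    tensorEval k B x (rename j p) = tensorEval k B (x ∘ j) p := by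
  simp [tensorEval, eval₂_rename, Function.comp_def]

theorem map_comp_tensorEval (f : A →ₐ[k] A') (x : σ → A) :
    (Algebra.TensorProduct.map f (AlgHom.id k B)).toRingHom.comp (tensorEval k B x) =
      tensorEval k B (f ∘ x) := by
  ext <;> simp

theorem tensorEval_eq_comp (x : σ → A) : tensorEval k B x =
    (((Algebra.TensorProduct.map (aeval x) (AlgHom.id k B)).comp
      (Algebra.TensorProduct.comm k B (MvPolynomial σ k)).toAlgHom).toRingHom.comp
      (algebraTensorAlgEquiv (σ := σ) k B).symm.toAlgHom.toRingHom) := by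
  ext
  · rename_i b
    have : (algebraTensorAlgEquiv (σ := σ) k B).symm (C b) = b ⊗ₜ 1 := by
      simpa using algebraTensorAlgEquiv_symm_monomial (σ := σ) k B 0 b
    simp [this]
  · simp

theorem flat_tensorEval {x : σ → A} (h : (aeval x : MvPolynomial σ k →ₐ[k] A).toRingHom.Flat) :
    (tensorEval k B x).Flat := by
  rw [tensorEval_eq_comp]
  refine .comp (.of_bijective (algebraTensorAlgEquiv k B).symm.bijective) (.comp ?_ ?_)
  · exact RingHom.Flat.of_bijective (Algebra.TensorProduct.comm k B (MvPolynomial σ k)).bijective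
  · exact RingHom.Flat.tensorProductMap (S := k) h (RingHom.Flat.id B)

end MvPolynomial

end tensorEval

theorem RingHom.flat_of_injective_of_field {D K : Type*} [CommRing D] [IsDomain D] [Field K]
    {f : D →+* K} (hf : Function.Injective f) : f.Flat := by
  have h : f = (IsFractionRing.lift (K := FractionRing D) hf).comp
      (algebraMap D (FractionRing D)) := by ext; simp
  rw [h]
  refine .comp ?_ (.of_isField (Field.toIsField _) _)
  rw [RingHom.flat_algebraMap_iff]
  exact IsLocalization.flat _ (nonZeroDivisors D)

open MvPolynomial in
/-- A prime lying over zero on the left factor does not drop in height when contracted along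
evaluation at an algebraically independent family. -/
theorem Ideal.height_comap_tensorEval_le {k C B σ : Type*} [Field k] [CommRing C] [IsDomain C]
    [CommRing B] [Algebra k C] [Algebra k B] {x : σ → C} (hx : AlgebraicIndependent k x)
    (Q : Ideal (C ⊗[k] B)) [hQ : Q.IsPrime]
    (hbot : Q.comap (Algebra.TensorProduct.includeLeft : C →ₐ[k] C ⊗[k] B) = ⊥) :
    (Q.comap (tensorEval k B x)).height ≤ Q.height := by
  let f : C →ₐ[k] FractionRing C := IsScalarTower.toAlgHom k C (FractionRing C)
  let φ := Algebra.TensorProduct.map f (AlgHom.id k B)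
  let : Algebra (C ⊗[k] B) (FractionRing C ⊗[k] B) := φ.toRingHom.toAlgebra
  have : IsScalarTower C (C ⊗[k] B) (FractionRing C ⊗[k] B) :=
    .of_algebraMap_eq fun c ↦ by
      simp [RingHom.algebraMap_toAlgebra, φ, f, Algebra.TensorProduct.algebraMap_apply]
  have hloc := IsLocalization.tensorProduct_tensorProduct k B (nonZeroDivisors C) (FractionRing C)
    (by ext; simp [RingHom.algebraMap_toAlgebra, φ])
  have hdisj : Disjoint
      (Algebra.algebraMapSubmonoid (C ⊗[k] B) (nonZeroDivisors C) : Set (C ⊗[k] B)) Q := by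
    rw [Set.disjoint_left]
    rintro _ ⟨c, hc, rfl⟩ hcQ
    refine nonZeroDivisors.ne_zero hc ?_
    rw [← Ideal.mem_bot, ← hbot]
    exact hcQ
  have hP := IsLocalization.isPrime_of_isPrime_disjoint _ (FractionRing C ⊗[k] B) Q hQ hdisj
  have hc := IsLocalization.under_map_of_isPrime_disjoint _ (FractionRing C ⊗[k] B) hQ hdisj
  rw [← IsLocalization.height_map_of_disjoint (S := FractionRing C ⊗[k] B) _ Q hdisj]
  have heq : (Q.map (algebraMap (C ⊗[k] B) (FractionRing C ⊗[k] B))).comap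
      (tensorEval k B (f ∘ x)) = Q.comap (tensorEval k B x) := by
    rw [← map_comp_tensorEval, ← Ideal.comap_comap]
    congr 1
  rw [← heq]
  refine Ideal.height_comap_le_of_flat (flat_tensorEval (RingHom.flat_of_injective_of_field ?_)) _
  exact hx.map' (f := f) (IsFractionRing.injective C (FractionRing C))

theorem Algebra.TensorProduct.ker_map_mk_right {k A B : Type*} [CommRing k] [CommRing A]
    [CommRing B] [Algebra k A] [Algebra k B] (q : Ideal B) :
    RingHom.ker (Algebra.TensorProduct.map (AlgHom.id k A) (Ideal.Quotient.mkₐ k q)).toRingHom =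
      q.map (Algebra.TensorProduct.includeRight : B →ₐ[k] A ⊗[k] B).toRingHom :=
  (Algebra.TensorProduct.lTensor_ker _ (Ideal.Quotient.mkₐ_surjective k q)).trans
    (congrArg _ (Ideal.Quotient.mkₐ_ker k q))

theorem Algebra.TensorProduct.ker_map_mk_left {k A B : Type*} [CommRing k] [CommRing A]
    [CommRing B] [Algebra k A] [Algebra k B] (p : Ideal A) :
    RingHom.ker (Algebra.TensorProduct.map (Ideal.Quotient.mkₐ k p) (AlgHom.id k B)).toRingHom =
      p.map (Algebra.TensorProduct.includeLeft : A →ₐ[k] A ⊗[k] B).toRingHom :=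
  (Algebra.TensorProduct.rTensor_ker _ (Ideal.Quotient.mkₐ_surjective k p)).trans
    (congrArg _ (Ideal.Quotient.mkₐ_ker k p))

theorem Algebra.TensorProduct.flat_includeLeft {k A B : Type*} [Field k] [CommRing A] [CommRing B]
    [Algebra k A] [Algebra k B] :
    (Algebra.TensorProduct.includeLeft : A →ₐ[k] A ⊗[k] B).toRingHom.Flat := by
  change (algebraMap A (A ⊗[k] B)).Flat
  rw [RingHom.flat_algebraMap_iff]
  infer_instance

open MvPolynomial in
theorem Ideal.height_map_C_le_height_map_includeRight {k A B σ : Type*} [Field k] [CommRing A]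
    [IsDomain A] [CommRing B] [Algebra k A] [Algebra k B] {x : σ → A}
    (hx : AlgebraicIndependent k x) (q : Ideal B) :
    (q.map (C : B →+* MvPolynomial σ B)).height ≤
      (q.map (Algebra.TensorProduct.includeRight : B →ₐ[k] A ⊗[k] B).toRingHom).height := by
  let π := Ideal.Quotient.mkₐ k q
  have hπ : Function.Surjective π := Ideal.Quotient.mkₐ_surjective k q
  let φ := (Algebra.TensorProduct.map (AlgHom.id k A) π).toRingHom
  have hφ : Function.Surjective φ :=
    Algebra.TensorProduct.map_surjective _ _ Function.surjective_id hπ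
  have hker : RingHom.ker φ = _ := Algebra.TensorProduct.ker_map_mk_right q
  have hφa (a : A) : φ (a ⊗ₜ 1) = a ⊗ₜ 1 := by simp [φ]
  clear_value φ
  rw [Ideal.height_eq_inf_minimalPrimes (q.map (AlgHom.toRingHom _))]
  refine le_iInf₂ fun Q hQ ↦ ?_
  have hQp : Q.IsPrime := hQ.1.1
  have hle := hQ.1.2
  rw [← hker, RingHom.ker_eq_comap_bot, Ideal.comap_minimalPrimes_eq_of_surjective hφ] at hQ
  obtain ⟨Q', hQ', rfl⟩ := hQ
  have : Q'.IsPrime := hQ'.1.1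
  have h0 : Q'.height = 0 := Ideal.height_eq_zero_iff.mpr hQ'
  have h1 := Ideal.height_comap_le_of_flat
    (Algebra.TensorProduct.flat_includeLeft (k := k) (A := A) (B := B ⧸ q)) Q'
  rw [h0, nonpos_iff_eq_zero, Ideal.height_eq_zero_iff_eq_bot] at h1
  have hbot : (Q'.comap φ).comap (Algebra.TensorProduct.includeLeft : A →ₐ[k] A ⊗[k] B) = ⊥ := by
    rw [← h1]
    ext a
    simp [Ideal.mem_comap, hφa]
  refine le_trans (Ideal.height_mono ?_) (Ideal.height_comap_tensorEval_le hx (Q'.comap φ) hbot)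
  rw [Ideal.map_le_iff_le_comap, Ideal.comap_comap, tensorEval_comp_C]
  exact Ideal.map_le_iff_le_comap.mp hle

theorem Ideal.height_map_mk_eq_of_ker_eq {R S : Type*} [CommRing R] [CommRing S] {f : R →+* S}
    (hf : Function.Surjective f) {I : Ideal R} (hI : RingHom.ker f = I) (P : Ideal R) :
    (P.map (Ideal.Quotient.mk I)).height = (P.map f).height := by
  subst hI
  exact (Ideal.height_map_of_ringEquiv_comp (RingHom.quotientKerEquivOfSurjective hf)
    (by ext; simp) P).symm

open MvPolynomial in
/-- The height of `P/(A ⊗ q)` is bounded below in terms of `P ∩ A` and the corank of a family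
of elements of `A` that stays independent over `B/q` modulo `P`. -/
theorem Ideal.exists_comap_tensorEval_eq_map_C.{u, v, w, z} {k : Type z} {A : Type u} {B : Type v}
    {σ : Type w} [Field k] [CommRing A] [CommRing B] [Algebra k A] [Algebra k B] [Finite σ]
    (P : Ideal (A ⊗[k] B)) [hP : P.IsPrime]
    {p : Ideal A}
    (hp : p = P.comap (Algebra.TensorProduct.includeLeft : A →ₐ[k] A ⊗[k] B).toRingHom)
    {q : Ideal B}
    (hq : q = P.comap (Algebra.TensorProduct.includeRight : B →ₐ[k] A ⊗[k] B).toRingHom)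
    {x : σ → A ⧸ p} (hx : AlgebraicIndependent k x) :
    ∃ (τ : Type w) (_ : Finite τ) (y : τ → A), P.comap (tensorEval k B y) = q.map C ∧
      p.height + Nat.card σ ≤ (P.map (Ideal.Quotient.mk (q.map
        (Algebra.TensorProduct.includeRight : B →ₐ[k] A ⊗[k] B).toRingHom))).height +
        Nat.card τ := by
  have hpp : p.IsPrime := hp ▸ inferInstance
  let φ := (Algebra.TensorProduct.map (AlgHom.id k A) (Ideal.Quotient.mkₐ k q)).toRingHom
  let ψ := (Algebra.TensorProduct.map (Ideal.Quotient.mkₐ k p) (AlgHom.id k (B ⧸ q))).toRingHom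
  have hφs : Function.Surjective φ := Algebra.TensorProduct.map_surjective _ _
    Function.surjective_id (Ideal.Quotient.mkₐ_surjective k q)
  have hψs : Function.Surjective ψ := Algebra.TensorProduct.map_surjective _ _
    (Ideal.Quotient.mkₐ_surjective k p) Function.surjective_id
  have hφk : RingHom.ker φ = _ := Algebra.TensorProduct.ker_map_mk_right q
  have hψk : RingHom.ker ψ = _ := Algebra.TensorProduct.ker_map_mk_left p
  have hφ (a : A) (b : B) : φ (a ⊗ₜ b) = a ⊗ₜ (Ideal.Quotient.mk q b) := rfl
  have hψ (a : A) (b : B ⧸ q) : ψ (a ⊗ₜ b) = (Ideal.Quotient.mk p a) ⊗ₜ b := rfl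
  clear_value φ ψ
  have hφP : RingHom.ker φ ≤ P := by
    rw [hφk, Ideal.map_le_iff_le_comap, hq]
  have hc1 : (P.map φ).comap φ = P := by
    rw [Ideal.comap_map_of_surjective φ hφs, ← RingHom.ker_eq_comap_bot, sup_eq_left.mpr hφP]
  have hp1 : (P.map φ).IsPrime := Ideal.map_isPrime_of_surjective hφs hφP
  have hψP : RingHom.ker ψ ≤ P.map φ := by
    rw [hψk, Ideal.map_le_iff_le_comap]
    intro a ha
    rw [hp] at ha
    have := Ideal.mem_map_of_mem φ (show a ⊗ₜ[k] (1 : B) ∈ P from ha)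
    rwa [hφ, map_one] at this
  have hc2 : ((P.map φ).map ψ).comap ψ = P.map φ := by
    rw [Ideal.comap_map_of_surjective ψ hψs, ← RingHom.ker_eq_comap_bot, sup_eq_left.mpr hψP]
  have hp2 : ((P.map φ).map ψ).IsPrime := Ideal.map_isPrime_of_surjective hψs hψP
  have hht : p.height + ((P.map φ).map ψ).height ≤ (P.map φ).height := by
    refine le_trans ?_ (Ideal.height_add_height_map_le_of_surjective hψs _ hψP)
    gcongr
    rw [hψk]
    exact Ideal.height_le_height_map_of_flat Algebra.TensorProduct.flat_includeLeft p
  have hmem (z : A ⊗[k] B) : ψ (φ z) ∈ (P.map φ).map ψ ↔ z ∈ P := by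
    rw [← Ideal.mem_comap, hc2, ← Ideal.mem_comap, hc1]
  generalize (P.map φ).map ψ = Q at *
  have hbotA : Q.comap
      (Algebra.TensorProduct.includeLeft : A ⧸ p →ₐ[k] (A ⧸ p) ⊗[k] (B ⧸ q)) = ⊥ := by
    rw [eq_bot_iff]
    intro a ha
    obtain ⟨a, rfl⟩ := Ideal.Quotient.mk_surjective a
    rw [Ideal.mem_bot, Ideal.Quotient.eq_zero_iff_mem, hp]
    have := hmem (a ⊗ₜ 1)
    rw [hφ, hψ, map_one] at this
    exact this.mp ha
  have hbotB : (Q.comap (tensorEval k (B ⧸ q) x)).comap C = ⊥ := by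
    rw [Ideal.comap_comap, tensorEval_comp_C, eq_bot_iff]
    intro b hb
    obtain ⟨b, rfl⟩ := Ideal.Quotient.mk_surjective b
    rw [Ideal.mem_bot, Ideal.Quotient.eq_zero_iff_mem, hq]
    have := hmem (1 ⊗ₜ b)
    rw [hφ, hψ, map_one] at this
    exact this.mp hb
  obtain ⟨τ, hτ, j, -, hj, hcard⟩ :=
    exists_comap_rename_eq_bot (Q.comap (tensorEval k (B ⧸ q) x)) hbotB
  choose y hy using fun i ↦ Ideal.Quotient.mk_surjective (x (j i))
  refine ⟨τ, hτ, y, ?_, ?_⟩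
  · have key (f : MvPolynomial τ B) : ψ (φ (tensorEval k B y f)) =
        tensorEval k (B ⧸ q) x (rename j (MvPolynomial.map (Ideal.Quotient.mk q) f)) := by
      rw [tensorEval_rename]
      induction f using MvPolynomial.induction_on with
      | C b => simp [hφ, hψ]
      | add f g hf hg => simp [hf, hg]
      | mul_X f i hf => simp [hf, hφ, hψ, hy]
    ext f
    rw [Ideal.mem_comap, ← hmem, key, ← Ideal.mem_comap, ← Ideal.mem_comap, hj, Ideal.mem_bot,
      ← RingHom.mem_ker, MvPolynomial.ker_map, Ideal.mk_ker]
  · rw [Ideal.height_map_mk_eq_of_ker_eq hφs hφk]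
    calc p.height + Nat.card σ ≤ p.height + (Q.height + Nat.card τ) := by
          gcongr
          refine hcard.trans ?_
          gcongr
          exact Ideal.height_comap_tensorEval_le hx Q hbotA
      _ ≤ _ := by rw [← add_assoc]; gcongr

theorem Ideal.height_le_height_comap_of_isIntegral {R S : Type*} [CommRing R] [CommRing S]
    {f : R →+* S} (hf : f.IsIntegral) (P : Ideal S) [hP : P.IsPrime] :
    P.height ≤ (P.comap f).height := by
  suffices H : ∀ (n : ℕ) (P : Ideal S), P.IsPrime → (n : ℕ∞) ≤ P.height →
      (n : ℕ∞) ≤ (P.comap f).height from ENat.forall_natCast_le_iff_le.mp fun n ↦ H n P hP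
  algebraize [f]
  intro n
  induction n with
  | zero => simp
  | succ n ih =>
    intro P hP h
    push_cast at h ⊢
    obtain ⟨Q, hQ, hlt, hn⟩ := exists_lt_le_height_of_add_one_le_height h
    have hlt' : Q.comap f < P.comap f := Ideal.IsIntegral.comap_lt_comap hlt
    exact (add_le_add_left (ih Q hQ hn) 1).trans (Ideal.height_add_one_le_of_lt_of_isPrime hlt')

theorem exists_algebraicIndependent_card_le {R D σ τ : Type*} [CommRing R] [Nontrivial R]
    [CommRing D] [IsDomain D] [Algebra R D] [FaithfulSMul R D] [Finite σ] (z : σ → D)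
    (hz : Algebra.IsIntegral (Algebra.adjoin R (Set.range z)) D) {y : τ → D}
    (hy : AlgebraicIndependent R y) :
    ∃ T : Set σ, AlgebraicIndependent R (fun i : T ↦ z i) ∧ Nat.card τ ≤ Nat.card T := by
  have := hz.isAlgebraic
  obtain ⟨t, hts, ht⟩ := exists_isTranscendenceBasis_subset (R := R) (Set.range z)
  obtain ⟨T, -, hT⟩ := Set.SurjOn.exists_bijOn_subset (f := z) (s := Set.univ) (t := t)
    (by rwa [Set.SurjOn, Set.image_univ])
  refine ⟨T, ht.1.comp (fun i : T ↦ (⟨z i, hT.mapsTo i.2⟩ : t)) fun i j h ↦ ?_, ?_⟩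
  · exact Subtype.ext (hT.injOn i.2 j.2 (congrArg Subtype.val h))
  · have hle := hy.lift_cardinalMk_le_trdeg
    rw [← ht.cardinalMk_eq_trdeg] at hle
    have hfin : Finite t := (Set.finite_range z).subset hts
    have heq : Nat.card T = Nat.card t := Nat.card_congr hT.equiv
    rw [heq, Nat.card, Nat.card]
    have h2 := Cardinal.toNat_le_toNat hle (by simp)
    simpa using h2

section

open MvPolynomial

variable {k A B σ τ : Type*} [Field k] [CommRing A] [CommRing B] [Algebra k A] [Algebra k B]

theorem algebraicIndependent_mk_tmul_one_iff {P : Ideal (A ⊗[k] B)} {q : Ideal B}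
    [Algebra (B ⧸ q) ((A ⊗[k] B) ⧸ P)]
    (halg : ∀ b, algebraMap (B ⧸ q) ((A ⊗[k] B) ⧸ P) (Ideal.Quotient.mk q b) =
      Ideal.Quotient.mk P (1 ⊗ₜ b)) (y : τ → A) :
    AlgebraicIndependent (B ⧸ q) (fun i ↦ Ideal.Quotient.mk P (y i ⊗ₜ 1)) ↔
      P.comap (tensorEval k B y) = q.map C := by
  have key (f : MvPolynomial τ B) :
      aeval (fun i ↦ Ideal.Quotient.mk P (y i ⊗ₜ 1)) (MvPolynomial.map (Ideal.Quotient.mk q) f) =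
        Ideal.Quotient.mk P (tensorEval k B y f) := by
    induction f using MvPolynomial.induction_on with
    | C b => simp [halg]
    | add f g hf hg => simp [hf, hg]
    | mul_X f i hf => simp [hf]
  have hq (f : MvPolynomial τ B) :
      MvPolynomial.map (Ideal.Quotient.mk q) f = 0 ↔ f ∈ q.map C := by
    rw [← RingHom.mem_ker, MvPolynomial.ker_map, Ideal.mk_ker]
  have hP (f : MvPolynomial τ B) :
      aeval (fun i ↦ Ideal.Quotient.mk P (y i ⊗ₜ 1))
        (MvPolynomial.map (Ideal.Quotient.mk q) f) = 0 ↔ f ∈ P.comap (tensorEval k B y) := by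
    rw [key, Ideal.Quotient.eq_zero_iff_mem, Ideal.mem_comap]
  rw [algebraicIndependent_iff]
  constructor
  · intro h
    ext f
    rw [← hP, ← hq]
    exact ⟨h _, fun h ↦ by rw [h, map_zero]⟩
  · intro h f hf
    obtain ⟨f, rfl⟩ := MvPolynomial.map_surjective _ Ideal.Quotient.mk_surjective f
    rwa [hq, ← h, ← hP]

theorem MvPolynomial.isIntegral_tensorEval {z : σ → A}
    (hz : (aeval z : MvPolynomial σ k →ₐ[k] A).toRingHom.IsIntegral) :
    (tensorEval k B z).IsIntegral := by
  have hcomp : (tensorEval k B z).comp (MvPolynomial.map (algebraMap k B)) =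
      (Algebra.TensorProduct.includeLeft : A →ₐ[k] A ⊗[k] B).toRingHom.comp
        (aeval z : MvPolynomial σ k →ₐ[k] A).toRingHom := by
    ext
    · simp [Algebra.TensorProduct.tmul_one_eq_one_tmul]
    · simp
  intro w
  induction w with
  | zero => exact RingHom.isIntegralElem_zero _
  | add v w hv hw => exact RingHom.IsIntegralElem.add _ hv hw
  | tmul a b =>
    rw [← mul_one a, ← one_mul b, ← Algebra.TensorProduct.tmul_mul_tmul]
    refine RingHom.IsIntegralElem.mul _ ?_ ?_
    · refine RingHom.IsIntegralElem.of_comp (f := MvPolynomial.map (algebraMap k B)) ?_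
      rw [hcomp]
      obtain ⟨p, hp, hpa⟩ := hz a
      refine ⟨p, hp, ?_⟩
      have := Polynomial.hom_eval₂ p (aeval z : MvPolynomial σ k →ₐ[k] A).toRingHom
        (Algebra.TensorProduct.includeLeft : A →ₐ[k] A ⊗[k] B).toRingHom a
      rw [hpa, map_zero] at this
      exact this.symm
    · rw [← tensorEval_C (k := k) z]
      exact RingHom.isIntegralElem_map _

theorem Ideal.height_add_card_le_of_isIntegral_aeval [Finite σ] {z : σ → A}
    (hz : (aeval z : MvPolynomial σ k →ₐ[k] A).toRingHom.IsIntegral)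
    (P : Ideal (A ⊗[k] B)) [hP : P.IsPrime] {q : Ideal B}
    (hq : q = P.comap (Algebra.TensorProduct.includeRight : B →ₐ[k] A ⊗[k] B).toRingHom)
    {y : τ → A} (hy : P.comap (tensorEval k B y) = q.map C) :
    P.height + Nat.card τ ≤ (q.map (C : B →+* MvPolynomial σ B)).height + Nat.card σ := by
  have hqp : q.IsPrime := hq ▸ inferInstance
  let alg : B ⧸ q →+* (A ⊗[k] B) ⧸ P := Ideal.quotientMap P
    (Algebra.TensorProduct.includeRight : B →ₐ[k] A ⊗[k] B).toRingHom hq.le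
  algebraize [alg]
  have halg (b : B) : algebraMap (B ⧸ q) ((A ⊗[k] B) ⧸ P) (Ideal.Quotient.mk q b) =
      Ideal.Quotient.mk P (1 ⊗ₜ b) := rfl
  have hfaith : FaithfulSMul (B ⧸ q) ((A ⊗[k] B) ⧸ P) := by
    rw [faithfulSMul_iff_algebraMap_injective]
    exact Ideal.quotientMap_injective' hq.ge
  rw [← algebraicIndependent_mk_tmul_one_iff halg] at hy
  let S := Algebra.adjoin (B ⧸ q) (Set.range fun i ↦ Ideal.Quotient.mk P (z i ⊗ₜ 1))
  have hint : Algebra.IsIntegral S ((A ⊗[k] B) ⧸ P) := by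
    have hmem (f : MvPolynomial σ B) : Ideal.Quotient.mk P (tensorEval k B z f) ∈ S := by
      induction f using MvPolynomial.induction_on with
      | C b => rw [tensorEval_C, ← halg]; exact S.algebraMap_mem _
      | add f g hf hg => rw [map_add, map_add]; exact add_mem hf hg
      | mul_X f i hf =>
        rw [map_mul, map_mul, tensorEval_X]
        exact mul_mem hf (Algebra.subset_adjoin ⟨i, rfl⟩)
    constructor
    intro d
    obtain ⟨d, rfl⟩ := Ideal.Quotient.mk_surjective d
    let h : MvPolynomial σ B →+* S :=
      ((Ideal.Quotient.mk P).comp (tensorEval k B z)).codRestrict S hmem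
    exact RingHom.IsIntegralElem.of_comp (f := h) (g := algebraMap S _)
      ((isIntegral_tensorEval hz d).map (Ideal.Quotient.mk P))
  obtain ⟨T, hT, hcard⟩ := exists_algebraicIndependent_card_le
    (fun i ↦ Ideal.Quotient.mk P (z i ⊗ₜ[k] (1 : B))) hint hy
  rw [algebraicIndependent_mk_tmul_one_iff halg] at hT
  have hTr : (P.comap (tensorEval k B z)).comap
      (rename (↑) : MvPolynomial T B →ₐ[B] MvPolynomial σ B) = q.map C := by
    rw [← hT]
    ext f
    simp only [Ideal.mem_comap, tensorEval_rename]
    rfl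
  have hle := height_le_height_map_add_card_compl (P.comap (tensorEval k B z)) q T hTr
  have hsum : Nat.card T + Nat.card (Tᶜ : Set σ) = Nat.card σ := by
    rw [Nat.card_coe_set_eq, Nat.card_coe_set_eq, Set.ncard_add_ncard_compl]
  calc P.height + Nat.card τ ≤ ((q.map C).height + Nat.card (Tᶜ : Set σ)) + Nat.card T := by
        gcongr
        exact (Ideal.height_le_height_comap_of_isIntegral (isIntegral_tensorEval hz) P).trans hle
    _ = _ := by rw [← hsum, add_assoc, Nat.cast_add, add_comm (Nat.card T : ℕ∞)]

theorem Algebra.TensorProduct.exists_finite_forall_mem_range (w : A ⊗[k] B) :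
    ∃ W : Set A, W.Finite ∧ ∀ S : Subalgebra k A, W ⊆ S →
      w ∈ (Algebra.TensorProduct.map S.val (AlgHom.id k B)).range := by
  induction w with
  | zero => exact ⟨∅, Set.finite_empty, fun S _ ↦ zero_mem _⟩
  | tmul a b => exact ⟨{a}, Set.finite_singleton a, fun S hS ↦ ⟨⟨a, hS rfl⟩ ⊗ₜ b, by simp⟩⟩
  | add v w hv hw =>
    obtain ⟨V, hV, hVS⟩ := hv
    obtain ⟨W, hW, hWS⟩ := hw
    exact ⟨V ∪ W, hV.union hW, fun S hS ↦ add_mem (hVS S (Set.subset_union_left.trans hS))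
      (hWS S (Set.subset_union_right.trans hS))⟩

/-- A finite lower bound on the height of a prime of `A ⊗ B` is already witnessed over every
subalgebra of `A` containing a suitable finite set. -/
theorem Ideal.exists_finite_forall_le_height_comap (n : ℕ) (P : Ideal (A ⊗[k] B)) [hP : P.IsPrime]
    (h : (n : ℕ∞) ≤ P.height) :
    ∃ W : Set A, W.Finite ∧ ∀ S : Subalgebra k A, W ⊆ S →
      (n : ℕ∞) ≤ (P.comap (Algebra.TensorProduct.map S.val (AlgHom.id k B))).height := by
  induction n generalizing P with
  | zero => exact ⟨∅, Set.finite_empty, fun S _ ↦ by simp⟩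
  | succ n ih =>
    push_cast at h ⊢
    obtain ⟨Q, hQ, hlt, hn⟩ := exists_lt_le_height_of_add_one_le_height h
    obtain ⟨W, hW, hWS⟩ := ih Q hn
    obtain ⟨hle, w, hwP, hwQ⟩ := SetLike.lt_iff_le_and_exists.mp hlt
    obtain ⟨V, hV, hVS⟩ := Algebra.TensorProduct.exists_finite_forall_mem_range w
    refine ⟨V ∪ W, hV.union hW, fun S hS ↦ ?_⟩
    obtain ⟨v, rfl⟩ := hVS S (Set.subset_union_left.trans hS)
    have hlt' : Q.comap (Algebra.TensorProduct.map S.val (AlgHom.id k B)) <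
        P.comap (Algebra.TensorProduct.map S.val (AlgHom.id k B)) :=
      SetLike.lt_iff_le_and_exists.mpr ⟨Ideal.comap_mono hle, v, hwP, hwQ⟩
    exact (add_le_add_left (hWS S (Set.subset_union_right.trans hS)) 1).trans
      (Ideal.height_add_one_le_of_lt_of_isPrime hlt')

theorem MvPolynomial.height_map_C_mono_of_le {R : Type*} [CommRing R] (q : Ideal R)
    {m n : ℕ} (h : m ≤ n) :
    (q.map (C : R →+* MvPolynomial (Fin m) R)).height ≤
      (q.map (C : R →+* MvPolynomial (Fin n) R)).height := by
  induction n, h using Nat.le_induction with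
  | base => rfl
  | succ n _ ih =>
    refine ih.trans ?_
    rw [← Ideal.height_map_of_ringEquiv_comp (finSuccEquiv R n).toRingEquiv
      (f := C) (g := Polynomial.C.comp C)
      (RingHom.ext fun r ↦ by simp [finSuccEquiv_apply]) q, ← Ideal.map_map]
    exact Ideal.height_le_height_map_of_flat Polynomial.flat_C _

/-- If every algebraically independent finite family in `A` has at most `n` members, then the
height of a prime of `A ⊗ B` lying over `q` is controlled by the height of `q[n]`. -/
theorem Ideal.height_add_card_le_height_map_C_add {n : ℕ}
    (hn : ∀ (m : ℕ) (z : Fin m → A), AlgebraicIndependent k z → m ≤ n) [Finite τ]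
    (P : Ideal (A ⊗[k] B)) [hP : P.IsPrime] {q : Ideal B}
    (hq : q = P.comap (Algebra.TensorProduct.includeRight : B →ₐ[k] A ⊗[k] B).toRingHom)
    {y : τ → A} (hy : P.comap (tensorEval k B y) = q.map C) :
    P.height + Nat.card τ ≤ (q.map (C : B →+* MvPolynomial (Fin n) B)).height + n := by
  suffices H : ∀ m : ℕ, (m : ℕ∞) ≤ P.height →
      (m : ℕ∞) + Nat.card τ ≤ (q.map (C : B →+* MvPolynomial (Fin n) B)).height + n by
    cases h : P.height with
    | coe m => exact H m h.ge
    | top =>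
      rw [top_add, top_le_iff, ENat.eq_top_iff_forall_ge]
      exact fun m ↦ le_self_add.trans (H m (h ▸ le_top))
  intro m hm
  obtain ⟨W, hW, hWS⟩ := Ideal.exists_finite_forall_le_height_comap m P hm
  let S := Algebra.adjoin k (W ∪ Set.range y)
  have hfg : Algebra.FiniteType k S :=
    (Subalgebra.fg_iff_finiteType _).mp ⟨(hW.union (Set.finite_range y)).toFinset, by simp [S]⟩
  let ι := Algebra.TensorProduct.map S.val (AlgHom.id k B)
  have hnt : Nontrivial (A ⊗[k] B) :=
    ⟨0, 1, fun h ↦ hP.ne_top ((Ideal.eq_top_iff_one P).mpr (h ▸ P.zero_mem))⟩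
  have hntA : Nontrivial A :=
    (Algebra.TensorProduct.includeLeft : A →ₐ[k] A ⊗[k] B).toRingHom.domain_nontrivial
  obtain ⟨s, g, hinj, hint⟩ := exists_integral_inj_algHom_of_fg k S
  obtain ⟨z, rfl⟩ : ∃ z : Fin s → S, g = aeval z := ⟨g ∘ X, by ext; simp⟩
  have hs : s ≤ n := hn s (S.val ∘ z) (AlgebraicIndependent.map' hinj Subtype.val_injective)
  let y' (i : τ) : S := ⟨y i, Algebra.subset_adjoin (Or.inr ⟨i, rfl⟩)⟩
  have hy' : (P.comap ι).comap (tensorEval k B y') = q.map C := by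
    rw [← hy, show y = S.val ∘ y' from rfl, ← map_comp_tensorEval]
    rfl
  have hq' : q = (P.comap ι).comap
      (Algebra.TensorProduct.includeRight : B →ₐ[k] S ⊗[k] B).toRingHom := by
    rw [hq]
    ext b
    simp [Ideal.mem_comap, ι]
  calc (m : ℕ∞) + Nat.card τ ≤ (P.comap ι).height + Nat.card τ := by
        gcongr
        exact hWS S fun a ha ↦ Algebra.subset_adjoin (Or.inl ha)
    _ ≤ (q.map (C : B →+* MvPolynomial (Fin s) B)).height + Nat.card (Fin s) :=
        Ideal.height_add_card_le_of_isIntegral_aeval hint (P.comap ι) hq' hy'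
    _ ≤ _ := by
        rw [Nat.card_fin]
        gcongr
        exact height_map_C_mono_of_le q hs

end

section

variable {k A : Type*} [Field k] [CommRing A] [Algebra k A] {n : ℕ}

theorem trdeg_eq_of_eTrdeg_eq (h : eTrdeg k A = n) : Algebra.trdeg k A = n :=
  Cardinal.toENat_eq_natCast.mp h

theorem exists_algebraicIndependent_of_eTrdeg_eq [IsDomain A] (h : eTrdeg k A = n) :
    ∃ x : Fin n → A, AlgebraicIndependent k x := by
  obtain ⟨s, hs⟩ := exists_isTranscendenceBasis k A
  have hcard := hs.cardinalMk_eq_trdeg.trans (trdeg_eq_of_eTrdeg_eq h)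
  obtain ⟨e⟩ := Cardinal.mk_eq_nat_iff.mp hcard
  exact ⟨_, hs.1.comp e.symm e.symm.injective⟩

theorem AlgebraicIndependent.le_of_eTrdeg_eq (h : eTrdeg k A = n) {m : ℕ} {z : Fin m → A}
    (hz : AlgebraicIndependent k z) : m ≤ n := by
  have := hz.lift_cardinalMk_le_trdeg
  rw [trdeg_eq_of_eTrdeg_eq h] at this
  simpa using this

end

/-- If `A` is an AF-domain and `P` is a prime of `A ⊗[k] B` with `q = P ∩ B`,
then `ht P = ht (A ⊗ q) + ht (P/(A ⊗ q))` and `ht (A ⊗ q) = ht (q[t.d.(A)])`. -/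
theorem stmt_5 (k A B : Type) [Field k] [CommRing A] [IsDomain A] [CommRing B]
    [Algebra k A] [Algebra k B]
    (ta : ℕ) (hta : eTrdeg k A = ta) (hBfin : eTrdeg k B ≠ ⊤)
    (hAF : IsAFDomain k A)
    (P : Ideal (A ⊗[k] B)) (hP : P.IsPrime)
    (q : Ideal B)
    (hq : q = P.comap (Algebra.TensorProduct.includeRight : B →ₐ[k] A ⊗[k] B).toRingHom) :
    idealHt P =
      idealHt (q.map (Algebra.TensorProduct.includeRight : B →ₐ[k] A ⊗[k] B).toRingHom) +
      idealHt (P.map (Ideal.Quotient.mk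
        (q.map (Algebra.TensorProduct.includeRight : B →ₐ[k] A ⊗[k] B).toRingHom))) ∧
    idealHt (q.map (Algebra.TensorProduct.includeRight : B →ₐ[k] A ⊗[k] B).toRingHom) =
      idealHt (polyExt ta q) := by
  have hp : (P.comap (Algebra.TensorProduct.includeLeft : A →ₐ[k] A ⊗[k] B).toRingHom).IsPrime :=
    inferInstance
  generalize hpP : P.comap (Algebra.TensorProduct.includeLeft : A →ₐ[k] A ⊗[k] B).toRingHom = p
    at hp
  have hAFp := hAF p hp
  rw [idealHt_eq_height_s5, hta] at hAFp
  obtain ⟨r, hr⟩ := ENat.ne_top_iff_exists.mp (show eTrdeg k (A ⧸ p) ≠ ⊤ by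
    intro h
    simp [h] at hAFp)
  rw [← hr] at hAFp
  obtain ⟨x, hx⟩ := exists_algebraicIndependent_of_eTrdeg_eq hta
  obtain ⟨w, hw⟩ := exists_algebraicIndependent_of_eTrdeg_eq hr.symm
  obtain ⟨τ, _, y, hy, hquot⟩ := Ideal.exists_comap_tensorEval_eq_map_C P hpP.symm hq hw
  rw [Nat.card_fin, hAFp] at hquot
  have hupper := Ideal.height_add_card_le_height_map_C_add
    (fun m z hz ↦ AlgebraicIndependent.le_of_eTrdeg_eq hta hz) P hq hy
  have hlower := Ideal.height_map_C_le_height_map_includeRight (B := B) hx q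
  have hqP : q.map (Algebra.TensorProduct.includeRight : B →ₐ[k] A ⊗[k] B).toRingHom ≤ P :=
    Ideal.map_le_iff_le_comap.mpr hq.le
  have hsum := Ideal.height_add_height_map_le_of_surjective Ideal.Quotient.mk_surjective P
    (Ideal.mk_ker.trans_le hqP)
  rw [Ideal.mk_ker] at hsum
  rw [polyExt]
  simp only [idealHt_eq_height_s5]
  generalize (q.map (MvPolynomial.C : B →+* MvPolynomial (Fin ta) B)).height = a at *
  generalize (q.map (Algebra.TensorProduct.includeRight : B →ₐ[k] A ⊗[k] B).toRingHom).height = b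
    at *
  generalize (P.map (Ideal.Quotient.mk
    (q.map (Algebra.TensorProduct.includeRight : B →ₐ[k] A ⊗[k] B).toRingHom))).height = c at *
  generalize P.height = d at *
  generalize Nat.card τ = t at *
  cases a with
  | top =>
    obtain rfl : b = ⊤ := top_le_iff.mp hlower
    rw [top_add, top_le_iff] at hsum
    simp [hsum]
  | coe a =>
    cases d with
    | top => exact absurd hupper (by norm_cast)
    | coe d =>
      cases b with
      | top => simp at hsum
      | coe b =>
        cases c with
        | top => simp at hsum
        | coe c =>
          norm_cast at *
          omega
end
end
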